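/- arXiv:2204.04760 — 2 statements merged into one kernel-verified Lean document; each statement's English description precedes it below -/
import Mathlib

section
/- Assume β > 157/17. For every T > 0, M ≥ 1 and ε ∈ (0,1] there exists a constant C > 0, depending only on M, ε and T, such that every smooth solution (v,u,θ,q) of the radiation hydrodynamics system on [0,T] with (M,ε)-bounded initial data satisfies ∫₀ᵗ ‖θ_{xx}(s,·)‖² ds ≤ C for all t ∈ [0,T]. -/
open MeasureTheory Real Set

noncomputable section

namespace RadHydro

/-- Integral over one period `[-1/2, 1/2]` of the torus `𝕋 ≅ ℝ/ℤ`. -/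
def tInt (f : ℝ → ℝ) : ℝ := ∫ x in (-(1/2) : ℝ)..(1/2 : ℝ), f x

/-- Squared `L²` norm over the torus. -/
def L2sq (f : ℝ → ℝ) : ℝ := tInt fun x => (f x) ^ 2

/-- `L^∞` norm over the torus. -/
def Linf (f : ℝ → ℝ) : ℝ := sSup ((fun x => |f x|) '' Icc (-(1/2) : ℝ) (1/2))

/-- Squared `H¹` norm over the torus. -/
def H1sq (f : ℝ → ℝ) : ℝ := L2sq f + L2sq (deriv f)

/-- Squared `H²` norm over the torus. -/
def H2sq (f : ℝ → ℝ) : ℝ := L2sq f + L2sq (deriv f) + L2sq (deriv (deriv f))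

/-- Partial derivative in the time variable. -/
def pt (f : ℝ → ℝ → ℝ) (t x : ℝ) : ℝ := deriv (fun s => f s x) t

/-- Partial derivative in the space variable. -/
def px (f : ℝ → ℝ → ℝ) (t x : ℝ) : ℝ := deriv (f t) x

/-- The heat conductivity `κ(v, θ) = κ₁ + κ₂ v θ^β`. -/
def kappa (κ₁ κ₂ β v θ : ℝ) : ℝ := κ₁ + κ₂ * v * θ ^ β

/-- A smooth solution of the radiation hydrodynamics system (in Lagrangian
coordinates) on `[0, T]`: four `C^∞` functions on `[0,T] × ℝ` (modelled as smooth
functions on all of `ℝ × ℝ`), `1`-periodic in the space variable, with `v > 0`,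
`θ > 0`, satisfying the four equations pointwise for `t ∈ [0, T]`, and with the
normalization `∫_𝕋 v(0, x) dx = 1`. -/
structure Sol (μ R a b κ₁ κ₂ β γ T : ℝ) where
  v : ℝ → ℝ → ℝ
  u : ℝ → ℝ → ℝ
  θ : ℝ → ℝ → ℝ
  q : ℝ → ℝ → ℝ
  smooth_v : ContDiff ℝ (⊤ : ℕ∞) fun p : ℝ × ℝ => v p.1 p.2
  smooth_u : ContDiff ℝ (⊤ : ℕ∞) fun p : ℝ × ℝ => u p.1 p.2
  smooth_θ : ContDiff ℝ (⊤ : ℕ∞) fun p : ℝ × ℝ => θ p.1 p.2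
  smooth_q : ContDiff ℝ (⊤ : ℕ∞) fun p : ℝ × ℝ => q p.1 p.2
  periodic_v : ∀ t, Function.Periodic (v t) 1
  periodic_u : ∀ t, Function.Periodic (u t) 1
  periodic_θ : ∀ t, Function.Periodic (θ t) 1
  periodic_q : ∀ t, Function.Periodic (q t) 1
  v_pos : ∀ t x, 0 < v t x
  θ_pos : ∀ t x, 0 < θ t x
  eq_mass : ∀ t ∈ Icc (0 : ℝ) T, ∀ x : ℝ, pt v t x - px u t x = 0
  eq_mom : ∀ t ∈ Icc (0 : ℝ) T, ∀ x : ℝ,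
    pt u t x + px (fun s y => R * θ s y / v s y) t x
      = px (fun s y => μ * px u s y / v s y) t x
  eq_energy : ∀ t ∈ Icc (0 : ℝ) T, ∀ x : ℝ,
    pt (fun s y => R / (γ - 1) * θ s y + (u s y) ^ 2 / 2) t x
      + px (fun s y => R * θ s y / v s y * u s y) t x + px q t x
      = px (fun s y => μ * u s y * px u s y / v s y) t x
        + px (fun s y => kappa κ₁ κ₂ β (v s y) (θ s y) * px θ s y / v s y) t x
  eq_rad : ∀ t ∈ Icc (0 : ℝ) T, ∀ x : ℝ,
    -px (fun s y => px q s y / v s y) t x + a * v t x * q t x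
      + b * px (fun s y => (θ s y) ^ 4) t x = 0
  mean_v : tInt (v 0) = 1

/-- `(M, ε)`-bounded initial data: `‖(v₀, u₀, θ₀)‖_{H²} ≤ M` and `v₀ ≥ ε`, `θ₀ ≥ ε`. -/
def DataBounded (M ε : ℝ) (v₀ u₀ θ₀ : ℝ → ℝ) : Prop :=
  Real.sqrt (H2sq v₀ + H2sq u₀ + H2sq θ₀) ≤ M ∧ (∀ x, ε ≤ v₀ x) ∧ ∀ x, ε ≤ θ₀ x

variable {μ R a b κ₁ κ₂ β γ T : ℝ}

/-- A solution has `(M, ε)`-bounded initial data. -/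
def Sol.Bounded (S : Sol μ R a b κ₁ κ₂ β γ T) (M ε : ℝ) : Prop :=
  DataBounded M ε (S.v 0) (S.u 0) (S.θ 0)

/-- The auxiliary function `𝔛(t) = ∫₀ᵗ ∫_𝕋 κ(v,θ) θ_t² / v dx ds`. -/
def Sol.X (S : Sol μ R a b κ₁ κ₂ β γ T) (t : ℝ) : ℝ :=
  ∫ s in (0 : ℝ)..t, tInt fun x =>
    kappa κ₁ κ₂ β (S.v s x) (S.θ s x) * (pt S.θ s x) ^ 2 / S.v s x

/-- The auxiliary function `𝔜(t) = max_{0 ≤ s ≤ t} ∫_𝕋 κ(v,θ)² θ_x² / v² dx`. -/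
def Sol.Y (S : Sol μ R a b κ₁ κ₂ β γ T) (t : ℝ) : ℝ :=
  sSup ((fun s => tInt fun x =>
    (kappa κ₁ κ₂ β (S.v s x) (S.θ s x)) ^ 2 * (px S.θ s x) ^ 2 / (S.v s x) ^ 2) ''
      Icc (0 : ℝ) t)

/-- The auxiliary function `ℨ(t) = max_{0 ≤ s ≤ t} ∫_𝕋 u_{xx}² / v² dx`. -/
def Sol.Z (S : Sol μ R a b κ₁ κ₂ β γ T) (t : ℝ) : ℝ :=
  sSup ((fun s => tInt fun x => (px (px S.u) s x) ^ 2 / (S.v s x) ^ 2) '' Icc (0 : ℝ) t)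

/-- The exponent `𝔗₀(n, p, β)`. -/
def T0 (n _p β : ℝ) : ℝ :=
  if n < (β + 3) / 2 then 4 / (n * (2 * β + 3)) else (n - β + 5) / (n * (2 * β + 3))

/-- The exponent `𝔗₁(n, β)`. -/
def T1 (n β : ℝ) : ℝ := max (T0 n 8 β) (1 / (2 * β + 3) + T0 n 1 β)

/-- The exponent `𝔘ʸ₁₁(n, β)`. -/
def Uy11 (n β : ℝ) : ℝ := 2 / (2 * β + 3) + T0 n 1 β

/-- The exponent `𝔘ᶻ₁₁(n, β)`. -/
def Uz11 (n β : ℝ) : ℝ := 3 / 4 * (1 / (1 - T0 n (5/2) β))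

/-- The exponent `𝔘ʸ₂(n, β)`. -/
def Uy2 (n β : ℝ) : ℝ := 2 / (2 * β + 3) + T1 n β

/-- The exponent `𝔘ᶻ₂(n, β)`. -/
def Uz2 (n β : ℝ) : ℝ := 3 / 4 * (1 / (1 - T0 n (3/2) β - T1 n β))

end RadHydro

open RadHydro

namespace RadHydro

/-! ### Smooth functions of time and space, periodic in space -/

/-- Smooth functions of `(t, x)` that are `1`-periodic in `x`. -/
structure SmoothPeriodic (f : ℝ → ℝ → ℝ) : Prop where
  contDiff : ContDiff ℝ (⊤ : ℕ∞) fun p : ℝ × ℝ => f p.1 p.2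
  periodic : ∀ t, Function.Periodic (f t) 1

namespace SmoothPeriodic

variable {f g : ℝ → ℝ → ℝ}

lemma continuous (hf : SmoothPeriodic f) : Continuous fun p : ℝ × ℝ => f p.1 p.2 :=
  hf.contDiff.continuous

lemma continuous_slice (hf : SmoothPeriodic f) (t : ℝ) : Continuous (f t) :=
  hf.continuous.comp (by fun_prop : Continuous fun x : ℝ => (t, x))

lemma continuous_time (hf : SmoothPeriodic f) (x : ℝ) : Continuous fun t => f t x :=
  hf.continuous.comp (by fun_prop : Continuous fun t : ℝ => (t, x))

lemma hasFDerivAt (hf : SmoothPeriodic f) (p : ℝ × ℝ) :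
    HasFDerivAt (fun p : ℝ × ℝ => f p.1 p.2)
      (fderiv ℝ (fun p : ℝ × ℝ => f p.1 p.2) p) p :=
  (hf.contDiff.differentiable (by simp) p).hasFDerivAt

lemma px_eq (hf : SmoothPeriodic f) (t x : ℝ) :
    px f t x = fderiv ℝ (fun p : ℝ × ℝ => f p.1 p.2) (t, x) (0, 1) := by
  have h := (hf.hasFDerivAt (t, x)).comp_hasDerivAt x
    ((hasDerivAt_const x t).prodMk (hasDerivAt_id x))
  exact h.deriv

lemma pt_eq (hf : SmoothPeriodic f) (t x : ℝ) :
    pt f t x = fderiv ℝ (fun p : ℝ × ℝ => f p.1 p.2) (t, x) (1, 0) := by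
  have h := (hf.hasFDerivAt (t, x)).comp_hasDerivAt t
    ((hasDerivAt_id t).prodMk (hasDerivAt_const t x))
  exact h.deriv

lemma hasDerivAt_px (hf : SmoothPeriodic f) (t x : ℝ) :
    HasDerivAt (fun y => f t y) (px f t x) x := by
  have h := (hf.hasFDerivAt (t, x)).comp_hasDerivAt x
    ((hasDerivAt_const x t).prodMk (hasDerivAt_id x))
  exact h.differentiableAt.hasDerivAt

lemma hasDerivAt_pt (hf : SmoothPeriodic f) (t x : ℝ) :
    HasDerivAt (fun s => f s x) (pt f t x) t := by
  have h := (hf.hasFDerivAt (t, x)).comp_hasDerivAt t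
    ((hasDerivAt_id t).prodMk (hasDerivAt_const t x))
  exact h.differentiableAt.hasDerivAt

lemma contDiff_fderiv (hf : SmoothPeriodic f) (e : ℝ × ℝ) :
    ContDiff ℝ (⊤ : ℕ∞) fun p : ℝ × ℝ => fderiv ℝ (fun p : ℝ × ℝ => f p.1 p.2) p e :=
  (hf.contDiff.fderiv_right (m := (⊤ : ℕ∞)) (by simp)).clm_apply contDiff_const

lemma px (hf : SmoothPeriodic f) : SmoothPeriodic (px f) where
  contDiff := by
    have : (fun p : ℝ × ℝ => RadHydro.px f p.1 p.2)
        = fun p => fderiv ℝ (fun p : ℝ × ℝ => f p.1 p.2) p (0, 1) := by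
      funext p; exact hf.px_eq p.1 p.2
    rw [this]; exact hf.contDiff_fderiv _
  periodic t x := by
    have h1 := (hf.hasDerivAt_px t (x + 1)).comp_add_const x 1
    have h2 := hf.hasDerivAt_px t x
    have : (fun y => f t (y + 1)) = fun y => f t y := funext (hf.periodic t)
    rw [this] at h1
    exact h1.unique h2

lemma pt (hf : SmoothPeriodic f) : SmoothPeriodic (pt f) where
  contDiff := by
    have : (fun p : ℝ × ℝ => RadHydro.pt f p.1 p.2)
        = fun p => fderiv ℝ (fun p : ℝ × ℝ => f p.1 p.2) p (1, 0) := by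
      funext p; exact hf.pt_eq p.1 p.2
    rw [this]; exact hf.contDiff_fderiv _
  periodic t x := by
    have : (fun s => f s (x + 1)) = fun s => f s x := funext fun s => hf.periodic s x
    simp only [RadHydro.pt, this]

lemma pt_px (hf : SmoothPeriodic f) (t x : ℝ) :
    RadHydro.pt (RadHydro.px f) t x = RadHydro.px (RadHydro.pt f) t x := by
  set Φ := fderiv ℝ (fun p : ℝ × ℝ => f p.1 p.2) with hΦ
  have hd : DifferentiableAt ℝ Φ (t, x) :=
    (hf.contDiff.fderiv_right (m := (⊤ : ℕ∞)) (by simp)).differentiable (by simp) _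
  have h1 : HasDerivAt (fun s => RadHydro.px f s x) (fderiv ℝ Φ (t, x) (1, 0) (0, 1)) t := by
    have h := hd.hasFDerivAt.comp_hasDerivAt t
      ((hasDerivAt_id t).prodMk (hasDerivAt_const t x))
    have h' := h.clm_apply (hasDerivAt_const t ((0 : ℝ), (1 : ℝ)))
    simpa [Function.comp_def, hf.px_eq] using h'
  have h2 : HasDerivAt (fun y => RadHydro.pt f t y) (fderiv ℝ Φ (t, x) (0, 1) (1, 0)) x := by
    have h := hd.hasFDerivAt.comp_hasDerivAt x
      ((hasDerivAt_const x t).prodMk (hasDerivAt_id x))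
    have h' := h.clm_apply (hasDerivAt_const x ((1 : ℝ), (0 : ℝ)))
    simpa [Function.comp_def, hf.pt_eq] using h'
  have hs : IsSymmSndFDerivAt ℝ (fun p : ℝ × ℝ => f p.1 p.2) (t, x) :=
    hf.contDiff.contDiffAt.isSymmSndFDerivAt (by
      simpa using (WithTop.coe_le_coe.2 (le_top : (2 : ℕ∞) ≤ ⊤)))
  exact (h1.deriv.trans (hs _ _)).trans h2.deriv.symm

lemma const (c : ℝ) : SmoothPeriodic fun _ _ => c :=
  ⟨contDiff_const, fun _ _ => rfl⟩

lemma add (hf : SmoothPeriodic f) (hg : SmoothPeriodic g) :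
    SmoothPeriodic fun t x => f t x + g t x :=
  ⟨hf.contDiff.add hg.contDiff, fun t x => by simp only [hf.periodic t x, hg.periodic t x]⟩

lemma sub (hf : SmoothPeriodic f) (hg : SmoothPeriodic g) :
    SmoothPeriodic fun t x => f t x - g t x :=
  ⟨hf.contDiff.sub hg.contDiff, fun t x => by simp only [hf.periodic t x, hg.periodic t x]⟩

lemma mul (hf : SmoothPeriodic f) (hg : SmoothPeriodic g) :
    SmoothPeriodic fun t x => f t x * g t x :=
  ⟨hf.contDiff.mul hg.contDiff, fun t x => by simp only [hf.periodic t x, hg.periodic t x]⟩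

lemma const_mul (c : ℝ) (hf : SmoothPeriodic f) : SmoothPeriodic fun t x => c * f t x :=
  (const c).mul hf

lemma div (hf : SmoothPeriodic f) (hg : SmoothPeriodic g) (h0 : ∀ t x, 0 < g t x) :
    SmoothPeriodic fun t x => f t x / g t x :=
  ⟨hf.contDiff.div hg.contDiff fun p => (h0 p.1 p.2).ne',
    fun t x => by simp only [hf.periodic t x, hg.periodic t x]⟩

lemma pow (hf : SmoothPeriodic f) (n : ℕ) : SmoothPeriodic fun t x => f t x ^ n :=
  ⟨hf.contDiff.pow n, fun t x => by simp only [hf.periodic t x]⟩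

lemma rpow (hf : SmoothPeriodic f) (h0 : ∀ t x, 0 < f t x) (c : ℝ) :
    SmoothPeriodic fun t x => f t x ^ c :=
  ⟨hf.contDiff.rpow_const_of_ne fun p => (h0 p.1 p.2).ne',
    fun t x => by simp only [hf.periodic t x]⟩

lemma log (hf : SmoothPeriodic f) (h0 : ∀ t x, 0 < f t x) :
    SmoothPeriodic fun t x => Real.log (f t x) :=
  ⟨hf.contDiff.log fun p => (h0 p.1 p.2).ne', fun t x => by simp only [hf.periodic t x]⟩

end SmoothPeriodic

/-! ### Integration over the torus -/

section TorusIntegral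

variable {f g h k : ℝ → ℝ}

lemma tInt_add (hf : Continuous f) (hg : Continuous g) :
    tInt (fun x => f x + g x) = tInt f + tInt g :=
  intervalIntegral.integral_add (hf.intervalIntegrable _ _) (hg.intervalIntegrable _ _)

lemma tInt_sub (hf : Continuous f) (hg : Continuous g) :
    tInt (fun x => f x - g x) = tInt f - tInt g :=
  intervalIntegral.integral_sub (hf.intervalIntegrable _ _) (hg.intervalIntegrable _ _)

lemma tInt_const_mul (c : ℝ) (f : ℝ → ℝ) : tInt (fun x => c * f x) = c * tInt f :=
  intervalIntegral.integral_const_mul _ _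

lemma tInt_mul_const (c : ℝ) (f : ℝ → ℝ) : tInt (fun x => f x * c) = tInt f * c :=
  intervalIntegral.integral_mul_const _ _

lemma tInt_const (c : ℝ) : tInt (fun _ => c) = c := by
  simp only [tInt, intervalIntegral.integral_const]; norm_num

lemma tInt_mono_on (hf : Continuous f) (hg : Continuous g)
    (hfg : ∀ x ∈ Icc (-(1 / 2) : ℝ) (1 / 2), f x ≤ g x) : tInt f ≤ tInt g :=
  intervalIntegral.integral_mono_on (by norm_num) (hf.intervalIntegrable _ _)
    (hg.intervalIntegrable _ _) hfg

lemma tInt_mono (hf : Continuous f) (hg : Continuous g) (hfg : ∀ x, f x ≤ g x) :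
    tInt f ≤ tInt g :=
  tInt_mono_on hf hg fun x _ => hfg x

lemma tInt_nonneg (hf : ∀ x, 0 ≤ f x) : 0 ≤ tInt f :=
  intervalIntegral.integral_nonneg (by norm_num) fun x _ => hf x

/-- The integral of the derivative of a periodic function vanishes. -/
lemma tInt_deriv_eq_zero (hp : Function.Periodic f 1) (hf : ∀ x, HasDerivAt f (g x) x)
    (hg : Continuous g) : tInt g = 0 := by
  rw [tInt, intervalIntegral.integral_eq_sub_of_hasDerivAt (fun x _ => hf x)
    (hg.intervalIntegrable _ _)]
  have := hp (-(1 / 2))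
  norm_num at this
  norm_num [this]

/-- Integration by parts on the torus. -/
lemma tInt_mul_deriv (hpf : Function.Periodic f 1) (hpg : Function.Periodic g 1)
    (hf : ∀ x, HasDerivAt f (h x) x) (hg : ∀ x, HasDerivAt g (k x) x)
    (hh : Continuous h) (hk : Continuous k) :
    tInt (fun x => f x * k x) = -tInt (fun x => h x * g x) := by
  have cf : Continuous f := continuous_iff_continuousAt.2 fun x => (hf x).continuousAt
  have cg : Continuous g := continuous_iff_continuousAt.2 fun x => (hg x).continuousAt
  have h0 : tInt (fun x => h x * g x + f x * k x) = 0 :=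
    tInt_deriv_eq_zero (hpf.mul hpg) (fun x => (hf x).mul (hg x)) (by fun_prop)
  rw [tInt_add (by fun_prop) (by fun_prop)] at h0
  linarith

lemma exists_mem_Icc_eq (hp : Function.Periodic f 1) (x : ℝ) :
    ∃ y ∈ Icc (-(1 / 2) : ℝ) (1 / 2), f x = f y := by
  obtain ⟨y, hy, h⟩ := hp.exists_mem_Ico one_pos x (-(1 / 2))
  exact ⟨y, ⟨hy.1, by have := hy.2; norm_num at this; linarith⟩, h⟩

lemma abs_intervalIntegral_le_tInt (hf : Continuous f) {x y : ℝ}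
    (hx : x ∈ Icc (-(1 / 2) : ℝ) (1 / 2)) (hy : y ∈ Icc (-(1 / 2) : ℝ) (1 / 2)) :
    |∫ z in x..y, f z| ≤ tInt fun z => |f z| := by
  rcases le_total x y with h | h
  · refine (intervalIntegral.abs_integral_le_integral_abs h).trans ?_
    exact intervalIntegral.integral_mono_interval hx.1 h hy.2
      (Filter.Eventually.of_forall fun z => abs_nonneg _)
      (hf.abs.intervalIntegrable _ _)
  · rw [intervalIntegral.integral_symm, abs_neg]
    refine (intervalIntegral.abs_integral_le_integral_abs h).trans ?_
    exact intervalIntegral.integral_mono_interval hy.1 h hx.2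
      (Filter.Eventually.of_forall fun z => abs_nonneg _)
      (hf.abs.intervalIntegrable _ _)

/-- A periodic function is bounded by its mean plus its total variation. -/
lemma le_tInt_add_tInt_abs_deriv (hp : Function.Periodic f 1)
    (hf : ∀ x, HasDerivAt f (g x) x) (hg : Continuous g) (x : ℝ) :
    f x ≤ tInt f + tInt fun y => |g y| := by
  have cf : Continuous f := continuous_iff_continuousAt.2 fun x => (hf x).continuousAt
  obtain ⟨x', hx', h⟩ := exists_mem_Icc_eq hp x
  rw [h]
  have key : tInt (fun _ => f x' - tInt fun y => |g y|) ≤ tInt f := by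
    refine tInt_mono_on continuous_const cf fun y hy => ?_
    have h1 := intervalIntegral.integral_eq_sub_of_hasDerivAt (a := y) (b := x')
      (fun z _ => hf z) (hg.intervalIntegrable _ _)
    have h2 := abs_intervalIntegral_le_tInt hg hy hx'
    have h3 := le_abs_self (∫ z in y..x', g z)
    linarith
  rw [tInt_const] at key
  linarith

/-- Pointwise bound of a periodic function by its `L²` norm and a small multiple of the
`L²` norm of its derivative. -/
lemma sq_le_tInt_sq (hp : Function.Periodic f 1) (hf : ∀ x, HasDerivAt f (g x) x)
    (hg : Continuous g) {η : ℝ} (hη : 0 < η) (x : ℝ) :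
    f x ^ 2 ≤ (1 + 1 / η) * tInt (fun y => f y ^ 2) + η * tInt fun y => g y ^ 2 := by
  have cf : Continuous f := continuous_iff_continuousAt.2 fun x => (hf x).continuousAt
  have h1 := le_tInt_add_tInt_abs_deriv (f := fun y => f y ^ 2) (g := fun y => 2 * f y * g y)
    (fun y => by simp only [hp y]) (fun y => by simpa using (hf y).fun_pow 2) (by fun_prop) x
  have h2 : tInt (fun y => |2 * f y * g y|)
      ≤ tInt fun y => 1 / η * f y ^ 2 + η * g y ^ 2 := by
    refine tInt_mono (by fun_prop) (by fun_prop) fun y => ?_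
    have e1 : 1 / η * f y ^ 2 + η * g y ^ 2 - 2 * f y * g y = (f y - η * g y) ^ 2 / η := by
      field_simp; ring
    have e2 : 1 / η * f y ^ 2 + η * g y ^ 2 + 2 * f y * g y = (f y + η * g y) ^ 2 / η := by
      field_simp; ring
    have p1 : 0 ≤ (f y - η * g y) ^ 2 / η := by positivity
    have p2 : 0 ≤ (f y + η * g y) ^ 2 / η := by positivity
    rw [abs_le]; constructor <;> linarith
  rw [tInt_add (by fun_prop) (by fun_prop), tInt_const_mul, tInt_const_mul] at h2
  linarith

/-- Continuous functions with geometrically bounded moments are bounded. -/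
lemma le_of_tInt_pow_le (hf : Continuous f) (hp : Function.Periodic f 1)
    (h0 : ∀ x, 0 ≤ f x) {B : ℝ} (hB : 0 < B)
    (hm : ∀ n : ℕ, tInt (fun x => f x ^ (n + 1)) ≤ B ^ (n + 1)) (x : ℝ) : f x ≤ B := by
  obtain ⟨x', hx', h⟩ := exists_mem_Icc_eq hp x
  rw [h]
  by_contra! hlt
  have hc : Continuous fun y => max (f y / B - 1) 0 := by fun_prop
  have hpos : 0 < tInt fun y => max (f y / B - 1) 0 := by
    refine intervalIntegral.integral_pos (by norm_num) hc.continuousOn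
      (fun y _ => le_max_right _ _) ⟨x', hx', lt_max_of_lt_left ?_⟩
    have : 1 < f x' / B := (one_lt_div hB).2 hlt
    linarith
  have hle : ∀ n : ℕ, (n + 1 : ℝ) * tInt (fun y => max (f y / B - 1) 0) ≤ 1 := fun n => by
    have h1 : tInt (fun y => (n + 1 : ℝ) * max (f y / B - 1) 0)
        ≤ tInt fun y => (1 / B ^ (n + 1)) * f y ^ (n + 1) := by
      refine tInt_mono (by fun_prop) (by fun_prop) fun y => ?_
      have e : (1 / B ^ (n + 1)) * f y ^ (n + 1) = (f y / B) ^ (n + 1) := by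
        rw [div_pow]; ring
      rw [e]
      have hq : 0 ≤ f y / B := div_nonneg (h0 y) hB.le
      rcases max_cases (f y / B - 1) 0 with ⟨h2, _⟩ | ⟨h2, _⟩
      · rw [h2]
        have := one_add_mul_le_pow (a := f y / B - 1) (by linarith) (n + 1)
        push_cast at this
        rw [add_sub_cancel] at this
        linarith
      · rw [h2, mul_zero]; positivity
    rw [tInt_const_mul, tInt_const_mul] at h1
    have h2 : 1 / B ^ (n + 1) * tInt (fun y => f y ^ (n + 1))
        ≤ 1 / B ^ (n + 1) * B ^ (n + 1) :=
      mul_le_mul_of_nonneg_left (hm n) (by positivity)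
    rw [one_div_mul_cancel (by positivity)] at h2
    linarith
  obtain ⟨n, hn⟩ := exists_nat_gt (1 / tInt fun y => max (f y / B - 1) 0)
  rw [div_lt_iff₀ hpos] at hn
  have := hle n
  nlinarith

end TorusIntegral

/-- Differentiation under the integral sign. -/
lemma hasDerivAt_intervalIntegral_param {f f' : ℝ → ℝ → ℝ} (a b : ℝ)
    (hf : ∀ t, Continuous (f t))
    (hf' : Continuous fun p : ℝ × ℝ => f' p.1 p.2)
    (hd : ∀ t x, HasDerivAt (fun s => f s x) (f' t x) t) (t : ℝ) :
    HasDerivAt (fun s => ∫ x in a..b, f s x) (∫ x in a..b, f' t x) t := by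
  have hK : IsCompact (Icc (t - 1) (t + 1) ×ˢ uIcc a b) := isCompact_Icc.prod isCompact_uIcc
  obtain ⟨C, hC⟩ := hK.exists_bound_of_continuousOn hf'.continuousOn
  refine (intervalIntegral.hasDerivAt_integral_of_dominated_loc_of_deriv_le
    (F := f) (F' := f') (bound := fun _ => C)
    (Icc_mem_nhds (sub_one_lt t) (lt_add_one t))
    (Filter.Eventually.of_forall fun s => (hf s).aestronglyMeasurable)
    ((hf t).intervalIntegrable _ _)
    (hf'.comp (by fun_prop : Continuous fun x : ℝ => (t, x))).aestronglyMeasurable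
    (Filter.Eventually.of_forall fun x hx s hs => ?_) intervalIntegrable_const
    (Filter.Eventually.of_forall fun x _ s _ => hd s x)).2
  exact hC (s, x) ⟨hs, uIoc_subset_uIcc hx⟩

lemma SmoothPeriodic.hasDerivAt_tInt {f : ℝ → ℝ → ℝ} (hf : SmoothPeriodic f) (t : ℝ) :
    HasDerivAt (fun s => tInt (f s)) (tInt (RadHydro.pt f t)) t :=
  hasDerivAt_intervalIntegral_param _ _ hf.continuous_slice hf.pt.continuous
    hf.hasDerivAt_pt t

lemma SmoothPeriodic.continuous_tInt {f : ℝ → ℝ → ℝ} (hf : SmoothPeriodic f) :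
    Continuous fun s => tInt (f s) :=
  continuous_iff_continuousAt.2 fun t => (hf.hasDerivAt_tInt t).continuousAt

lemma SmoothPeriodic.tInt_px {f : ℝ → ℝ → ℝ} (hf : SmoothPeriodic f) (t : ℝ) :
    tInt (RadHydro.px f t) = 0 :=
  tInt_deriv_eq_zero (hf.periodic t) (hf.hasDerivAt_px t) (hf.px.continuous_slice t)

lemma SmoothPeriodic.tInt_mul_px {f g : ℝ → ℝ → ℝ} (hf : SmoothPeriodic f)
    (hg : SmoothPeriodic g) (t : ℝ) :
    tInt (fun x => f t x * RadHydro.px g t x) = -tInt fun x => RadHydro.px f t x * g t x :=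
  tInt_mul_deriv (hf.periodic t) (hg.periodic t) (hf.hasDerivAt_px t) (hg.hasDerivAt_px t)
    (hf.px.continuous_slice t) (hg.px.continuous_slice t)

/-- A Grönwall inequality with dissipation. -/
lemma gronwall_dissipation {T A G Y : ℝ} {y y' α g d : ℝ → ℝ} (hT : 0 ≤ T)
    (hα : Continuous α) (hg : Continuous g) (hd : Continuous d)
    (hα0 : ∀ t, 0 ≤ α t) (hg0 : ∀ t, 0 ≤ g t) (hd0 : ∀ t, 0 ≤ d t) (hy0 : ∀ t, 0 ≤ y t)
    (hy : ∀ t, HasDerivAt y (y' t) t)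
    (h : ∀ t ∈ Icc 0 T, y' t + d t ≤ α t * y t + g t)
    (hA : ∫ s in (0 : ℝ)..T, α s ≤ A) (hG : ∫ s in (0 : ℝ)..T, g s ≤ G) (hY : y 0 ≤ Y) :
    ∀ t ∈ Icc 0 T, y t + ∫ s in (0 : ℝ)..t, d s ≤ exp A * (Y + G) := by
  have prim : ∀ {f : ℝ → ℝ}, Continuous f → ∀ t,
      HasDerivAt (fun t => ∫ s in (0 : ℝ)..t, f s) (f t) t := fun hf t =>
    intervalIntegral.integral_hasDerivAt_right (hf.intervalIntegrable _ _)
      hf.aestronglyMeasurable.stronglyMeasurableAtFilter hf.continuousAt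
  have mono : ∀ {f : ℝ → ℝ}, Continuous f → (∀ t, 0 ≤ f t) → ∀ t ∈ Icc 0 T,
      0 ≤ ∫ s in (0 : ℝ)..t, f s ∧ ∫ s in (0 : ℝ)..t, f s ≤ ∫ s in (0 : ℝ)..T, f s :=
    fun hf h0 t ht => ⟨intervalIntegral.integral_nonneg ht.1 fun s _ => h0 s,
      intervalIntegral.integral_mono_interval le_rfl ht.1 ht.2
        (Filter.Eventually.of_forall h0) (hf.intervalIntegrable _ _)⟩
  set a : ℝ → ℝ := fun t => ∫ s in (0 : ℝ)..t, α s with ha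
  have hda : ∀ t, HasDerivAt a (α t) t := prim hα
  set z : ℝ → ℝ := fun t => y t * exp (-a t) + exp (-A) * (∫ s in (0 : ℝ)..t, d s)
    - ∫ s in (0 : ℝ)..t, g s with hz
  have hdz : ∀ t, HasDerivAt z
      (y' t * exp (-a t) + y t * (exp (-a t) * -α t) + exp (-A) * d t - g t) t := fun t =>
    (((hy t).mul (hda t).neg.exp).add ((prim hd t).const_mul _)).sub (prim hg t)
  have hanti : AntitoneOn z (Icc 0 T) := by
    refine antitoneOn_of_hasDerivWithinAt_nonpos (convex_Icc 0 T)
      (fun t _ => (hdz t).continuousAt.continuousWithinAt)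
      (fun t _ => (hdz t).hasDerivWithinAt) fun t ht => ?_
    rw [interior_Icc] at ht
    have ht' : t ∈ Icc 0 T := ⟨ht.1.le, ht.2.le⟩
    have h1 := mul_le_mul_of_nonneg_right (h t ht') (exp_pos (-a t)).le
    have h2 : exp (-A) ≤ exp (-a t) := by
      refine exp_le_exp.2 (neg_le_neg ?_)
      exact (mono hα hα0 t ht').2.trans hA
    have h3 : exp (-a t) ≤ 1 := exp_le_one_iff.2 (neg_nonpos.2 (mono hα hα0 t ht').1)
    have h4 := mul_le_mul_of_nonneg_right h2 (hd0 t)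
    have h5 := mul_le_mul_of_nonneg_left h3 (hg0 t)
    linarith
  intro t ht
  have h1 := hanti (left_mem_Icc.2 hT) ht ht.1
  simp only [hz, ha, intervalIntegral.integral_same, neg_zero, exp_zero, mul_one, mul_zero,
    add_zero, sub_zero] at h1
  have h2 : exp (-A) ≤ exp (-a t) := exp_le_exp.2 (neg_le_neg ((mono hα hα0 t ht).2.trans hA))
  have h3 := mul_le_mul_of_nonneg_left h2 (hy0 t)
  have h4 := (mono hg hg0 t ht).2
  have h5 : exp (-A) * (y t + ∫ s in (0 : ℝ)..t, d s) ≤ Y + G := by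
    rw [ha] at h3
    linarith
  calc y t + ∫ s in (0 : ℝ)..t, d s
      = exp A * (exp (-A) * (y t + ∫ s in (0 : ℝ)..t, d s)) := by
        rw [← mul_assoc, ← exp_add, add_neg_cancel, exp_zero, one_mul]
    _ ≤ _ := mul_le_mul_of_nonneg_left h5 (exp_pos _).le

/-! ### Reformulation of the system -/

/-- The standing assumptions on the constants. -/
structure Admissible (μ R a b κ₁ κ₂ β γ T M ε : ℝ) : Prop where
  μ_pos : 0 < μ
  R_pos : 0 < R
  a_pos : 0 < a
  b_pos : 0 < b
  κ₁_pos : 0 < κ₁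
  κ₂_pos : 0 < κ₂
  two_le_β : 2 ≤ β
  one_lt_γ : 1 < γ
  T_pos : 0 < T
  one_le_M : 1 ≤ M
  ε_pos : 0 < ε
  ε_le_one : ε ≤ 1

lemma Admissible.cv_pos {μ R a b κ₁ κ₂ β γ T M ε : ℝ}
    (H : Admissible μ R a b κ₁ κ₂ β γ T M ε) : 0 < R / (γ - 1) :=
  div_pos H.R_pos (sub_pos.2 H.one_lt_γ)

namespace Sol

variable {μ R a b κ₁ κ₂ β γ T M ε : ℝ} (S : Sol μ R a b κ₁ κ₂ β γ T)

lemma hv : SmoothPeriodic S.v := ⟨S.smooth_v, S.periodic_v⟩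
lemma hu : SmoothPeriodic S.u := ⟨S.smooth_u, S.periodic_u⟩
lemma hθ : SmoothPeriodic S.θ := ⟨S.smooth_θ, S.periodic_θ⟩
lemma hq : SmoothPeriodic S.q := ⟨S.smooth_q, S.periodic_q⟩

/-- The pressure `Rθ/v`. -/
def pressure (t x : ℝ) : ℝ := R * S.θ t x / S.v t x

/-- The total stress `μ u_x/v - Rθ/v`. -/
def stress (t x : ℝ) : ℝ := μ * px S.u t x / S.v t x - S.pressure t x

/-- The Lagrangian conductivity `κ(v,θ)/v`. -/
def cond (t x : ℝ) : ℝ := κ₁ / S.v t x + κ₂ * S.θ t x ^ β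

/-- The conductive heat flux `κ(v,θ) θ_x/v`. -/
def flux (t x : ℝ) : ℝ := S.cond t x * px S.θ t x

/-- The radiative energy density `b θ⁴ - q_x/v`. -/
def rad (t x : ℝ) : ℝ := b * S.θ t x ^ 4 - px S.q t x / S.v t x

lemma hpressure : SmoothPeriodic S.pressure := (S.hθ.const_mul R).div S.hv S.v_pos

lemma hstress : SmoothPeriodic S.stress :=
  ((S.hu.px.const_mul μ).div S.hv S.v_pos).sub S.hpressure

lemma hcond : SmoothPeriodic S.cond :=
  ((SmoothPeriodic.const κ₁).div S.hv S.v_pos).add ((S.hθ.rpow S.θ_pos β).const_mul κ₂)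

lemma hflux : SmoothPeriodic S.flux := S.hcond.mul S.hθ.px

lemma hrad : SmoothPeriodic S.rad := ((S.hθ.pow 4).const_mul b).sub (S.hq.px.div S.hv S.v_pos)

variable {S}

lemma pt_v {t : ℝ} (ht : t ∈ Icc 0 T) (x : ℝ) : pt S.v t x = px S.u t x :=
  sub_eq_zero.1 (S.eq_mass t ht x)

lemma pt_u {t : ℝ} (ht : t ∈ Icc 0 T) (x : ℝ) : pt S.u t x = px S.stress t x := by
  have h := S.eq_mom t ht x
  have h1 := ((S.hu.px.const_mul μ).div S.hv S.v_pos).hasDerivAt_px t x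
  have h2 := S.hpressure.hasDerivAt_px t x
  have h3 : px S.stress t x = _ := (h1.sub h2).deriv
  rw [h3, ← h]
  exact (add_sub_cancel_right _ _).symm

lemma energy_eq {t : ℝ} (ht : t ∈ Icc 0 T) (x : ℝ) :
    R / (γ - 1) * pt S.θ t x
      = px S.flux t x - px S.q t x + S.stress t x * px S.u t x := by
  have h := S.eq_energy t ht x
  have e1 : pt (fun s y => R / (γ - 1) * S.θ s y + (S.u s y) ^ 2 / 2) t x
      = R / (γ - 1) * pt S.θ t x + S.u t x * pt S.u t x := by
    have := ((S.hθ.hasDerivAt_pt t x).const_mul (R / (γ - 1))).add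
      (((S.hu.hasDerivAt_pt t x).fun_pow 2).div_const 2)
    refine this.deriv.trans ?_
    push_cast; ring
  have e2 : px (fun s y => R * S.θ s y / S.v s y * S.u s y) t x
      = px S.pressure t x * S.u t x + S.pressure t x * px S.u t x :=
    ((S.hpressure.hasDerivAt_px t x).mul (S.hu.hasDerivAt_px t x)).deriv
  have e3 : px (fun s y => kappa κ₁ κ₂ β (S.v s y) (S.θ s y) * px S.θ s y / S.v s y) t x
      = px S.flux t x := by
    congr 2
    funext s y
    have := (S.v_pos s y).ne'
    simp only [kappa, flux, cond]
    field_simp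
  have e4 : px (fun s y => μ * S.u s y * px S.u s y / S.v s y) t x
      = px S.u t x * (S.stress t x + S.pressure t x)
        + S.u t x * (px S.stress t x + px S.pressure t x) := by
    have : (fun s y => μ * S.u s y * px S.u s y / S.v s y)
        = fun s y => S.u s y * (S.stress s y + S.pressure s y) := by
      funext s y; simp only [stress]; ring
    rw [this]
    exact ((S.hu.hasDerivAt_px t x).mul
      ((S.hstress.hasDerivAt_px t x).add (S.hpressure.hasDerivAt_px t x))).deriv
  rw [e1, e2, e3, e4, pt_u ht] at h
  linarith

lemma px_q (t x : ℝ) : px S.q t x = S.v t x * (b * S.θ t x ^ 4 - S.rad t x) := by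
  have := (S.v_pos t x).ne'
  simp only [rad]
  field_simp
  ring

lemma px_rad {t : ℝ} (ht : t ∈ Icc 0 T) (x : ℝ) :
    px S.rad t x = -(a * S.v t x * S.q t x) := by
  have h := S.eq_rad t ht x
  have h1 := ((S.hθ.pow 4).hasDerivAt_px t x).const_mul b
  have h2 := (S.hq.px.div S.hv S.v_pos).hasDerivAt_px t x
  have h3 : px S.rad t x = _ := (h1.sub h2).deriv
  rw [h3]
  linarith

lemma rad_pos (H : Admissible μ R a b κ₁ κ₂ β γ T M ε) {t : ℝ} (ht : t ∈ Icc 0 T) (x : ℝ) :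
    0 < S.rad t x := by
  obtain ⟨x₀, -, hx₀⟩ := (isCompact_Icc (a := (-(1 / 2) : ℝ)) (b := 1 / 2)).exists_isMinOn
    ⟨0, by norm_num, by norm_num⟩ (S.hrad.continuous_slice t).continuousOn
  have hmin : ∀ y, S.rad t x₀ ≤ S.rad t y := fun y => by
    obtain ⟨z, hz, h⟩ := exists_mem_Icc_eq (S.hrad.periodic t) y
    rw [h]; exact hx₀ hz
  refine lt_of_lt_of_le ?_ (hmin x)
  by_contra! hle
  have hd : deriv (S.rad t) = fun y => -(a * S.v t y * S.q t y) :=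
    funext fun y => px_rad ht y
  have hloc : IsLocalMin (S.rad t) x₀ := Filter.Eventually.of_forall hmin
  have hd0 : deriv (S.rad t) x₀ = 0 := hloc.deriv_eq_zero
  have hq0 : S.q t x₀ = 0 := by
    rw [hd] at hd0
    have := (mul_pos H.a_pos (S.v_pos t x₀)).ne'
    simpa [this, H.a_pos.ne', (S.v_pos t x₀).ne'] using hd0
  have hqx : 0 < px S.q t x₀ := by
    rw [px_q]
    have := mul_pos H.b_pos (pow_pos (S.θ_pos t x₀) 4)
    exact mul_pos (S.v_pos t x₀) (by linarith)
  have hdd : deriv (deriv (S.rad t)) x₀ = -(a * S.v t x₀ * px S.q t x₀) := by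
    rw [hd]
    have := (((S.hv.hasDerivAt_px t x₀).const_mul a).mul (S.hq.hasDerivAt_px t x₀)).neg
    refine this.deriv.trans ?_
    rw [hq0]; ring
  have hneg : deriv (deriv (S.rad t)) x₀ < 0 := by
    rw [hdd]
    have := mul_pos (mul_pos H.a_pos (S.v_pos t x₀)) hqx
    linarith
  have hmax : IsLocalMax (S.rad t) x₀ := by
    have := isLocalMin_of_deriv_deriv_pos (f := fun y => -S.rad t y) (x₀ := x₀)
      (by simpa using hneg) (by simpa using hd0)
      (S.hrad.continuous_slice t).neg.continuousAt
    simpa using this.neg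
  have hconst : S.rad t =ᶠ[nhds x₀] fun _ => S.rad t x₀ := by
    filter_upwards [hmax, hloc] with y h1 h2 using le_antisymm h1 h2
  have := hconst.deriv.deriv_eq
  simp at this
  exact hneg.ne this

/-- Radiation dissipates every increasing function of the temperature. -/
lemma tInt_px_q_mul_nonneg (H : Admissible μ R a b κ₁ κ₂ β γ T M ε) {t : ℝ}
    (ht : t ∈ Icc 0 T) {G G' : ℝ → ℝ} (hG : ∀ s, 0 < s → HasDerivAt G (G' s) s)
    (hG' : ContinuousOn G' (Ioi 0)) (hpos : ∀ s, 0 < s → 0 ≤ G' s) :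
    0 ≤ tInt fun x => px S.q t x * G (b * S.θ t x ^ 4) := by
  have hB : ∀ x, 0 < b * S.θ t x ^ 4 := fun x => mul_pos H.b_pos (pow_pos (S.θ_pos t x) 4)
  have hw := fun x => rad_pos (S := S) H ht x
  have cθ := S.hθ.continuous_slice t
  have cw := S.hrad.continuous_slice t
  have cq := S.hq.continuous_slice t
  have cqx := S.hq.px.continuous_slice t
  have cv := S.hv.continuous_slice t
  have hGc : ContinuousOn G (Ioi 0) := fun s hs => (hG s hs).continuousAt.continuousWithinAt
  have hmono : MonotoneOn G (Ioi 0) :=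
    monotoneOn_of_hasDerivWithinAt_nonneg (convex_Ioi 0) hGc
      (fun s hs => (hG s (interior_subset hs)).hasDerivWithinAt)
      fun s hs => hpos s (interior_subset hs)
  have cGw : Continuous fun x => G (S.rad t x) := hGc.comp_continuous cw hw
  have cGB : Continuous fun x => G (b * S.θ t x ^ 4) :=
    hGc.comp_continuous (by fun_prop) hB
  have cG'w : Continuous fun x => G' (S.rad t x) := hG'.comp_continuous cw hw
  have hdG : ∀ x, HasDerivAt (fun y => G (S.rad t y))
      (G' (S.rad t x) * -(a * S.v t x * S.q t x)) x := fun x => by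
    rw [← px_rad ht]
    exact (hG _ (hw x)).comp x (S.hrad.hasDerivAt_px t x)
  have h1 := tInt_mul_deriv (f := fun y => G (S.rad t y)) (g := S.q t)
    (fun x => by simp only [S.hrad.periodic t x]) (S.hq.periodic t) hdG
    (S.hq.hasDerivAt_px t) (cG'w.mul (by fun_prop)) cqx
  have h2 : 0 ≤ tInt fun x => G (S.rad t x) * px S.q t x := by
    rw [h1]
    have : (fun x => G' (S.rad t x) * -(a * S.v t x * S.q t x) * S.q t x)
        = fun x => -1 * (G' (S.rad t x) * (a * S.v t x * S.q t x ^ 2)) := by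
      funext x; ring
    rw [this, tInt_const_mul]
    have : 0 ≤ tInt fun x => G' (S.rad t x) * (a * S.v t x * S.q t x ^ 2) :=
      tInt_nonneg fun x => mul_nonneg (hpos _ (hw x))
        (mul_nonneg (mul_pos H.a_pos (S.v_pos t x)).le (sq_nonneg _))
    linarith
  refine h2.trans (tInt_mono (cGw.mul cqx) (cqx.mul cGB) fun x => ?_)
  have h3 : 0 ≤ (b * S.θ t x ^ 4 - S.rad t x) * (G (b * S.θ t x ^ 4) - G (S.rad t x)) := by
    rcases le_total (b * S.θ t x ^ 4) (S.rad t x) with h | h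
    · exact mul_nonneg_of_nonpos_of_nonpos (by linarith)
        (by linarith [hmono (hB x) (hw x) h])
    · exact mul_nonneg (by linarith) (by linarith [hmono (hw x) (hB x) h])
  have h4 := mul_nonneg (S.v_pos t x).le h3
  rw [px_q]
  linarith

end Sol

lemma intervalIntegral_le_sub_of_le_deriv {T : ℝ} {y y' d : ℝ → ℝ} (hd : Continuous d)
    (hy : ∀ t, HasDerivAt y (y' t) t) (h : ∀ t ∈ Icc 0 T, d t ≤ y' t) :
    ∀ t ∈ Icc 0 T, ∫ s in (0 : ℝ)..t, d s ≤ y t - y 0 := by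
  have prim : ∀ t, HasDerivAt (fun t => ∫ s in (0 : ℝ)..t, d s) (d t) t := fun t =>
    intervalIntegral.integral_hasDerivAt_right (hd.intervalIntegrable _ _)
      hd.aestronglyMeasurable.stronglyMeasurableAtFilter hd.continuousAt
  have hz : ∀ t, HasDerivAt (fun t => y t - ∫ s in (0 : ℝ)..t, d s) (y' t - d t) t :=
    fun t => (hy t).sub (prim t)
  have hmono : MonotoneOn (fun t => y t - ∫ s in (0 : ℝ)..t, d s) (Icc 0 T) :=
    monotoneOn_of_hasDerivWithinAt_nonneg (convex_Icc 0 T)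
      (fun t _ => (hz t).continuousAt.continuousWithinAt)
      (fun t _ => (hz t).hasDerivWithinAt)
      fun t ht => sub_nonneg.2 (h t (interior_subset ht))
  intro t ht
  have := hmono (left_mem_Icc.2 (ht.1.trans ht.2)) ht ht.1
  simp only [intervalIntegral.integral_same, sub_zero] at this
  linarith

lemma eq_of_deriv_eq_zero_on {T : ℝ} {y y' : ℝ → ℝ}
    (hy : ∀ t, HasDerivAt y (y' t) t) (h : ∀ t ∈ Icc 0 T, y' t = 0) :
    ∀ t ∈ Icc 0 T, y t = y 0 := by
  intro t ht
  have h1 := intervalIntegral_le_sub_of_le_deriv (d := fun _ => 0) continuous_const hy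
    (fun t ht => (h t ht).ge) t ht
  have h2 := intervalIntegral_le_sub_of_le_deriv (d := fun _ => 0) continuous_const
    (fun t => (hy t).neg) (fun t ht => (neg_eq_zero.2 (h t ht)).ge) t ht
  simp only [intervalIntegral.integral_zero, Pi.neg_apply] at h1 h2
  linarith

namespace Sol

variable {μ R a b κ₁ κ₂ β γ T M ε : ℝ}

/-! ### Initial data -/

lemma Bounded.data {S : Sol μ R a b κ₁ κ₂ β γ T} (hS : S.Bounded M ε) :
    (tInt (fun x => S.v 0 x ^ 2) ≤ M ^ 2 ∧ tInt (fun x => px S.v 0 x ^ 2) ≤ M ^ 2) ∧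
    (tInt (fun x => S.u 0 x ^ 2) ≤ M ^ 2 ∧ tInt (fun x => px S.u 0 x ^ 2) ≤ M ^ 2) ∧
    (tInt (fun x => S.θ 0 x ^ 2) ≤ M ^ 2 ∧ tInt (fun x => px S.θ 0 x ^ 2) ≤ M ^ 2) := by
  have h := hS.1
  have hM : 0 ≤ M := (Real.sqrt_nonneg _).trans h
  rw [Real.sqrt_le_left hM] at h
  have hn : ∀ f : ℝ → ℝ, 0 ≤ L2sq f := fun f => tInt_nonneg fun x => sq_nonneg _
  simp only [H2sq] at h
  have a1 := hn (S.v 0); have a2 := hn (deriv (S.v 0)); have a3 := hn (deriv (deriv (S.v 0)))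
  have b1 := hn (S.u 0); have b2 := hn (deriv (S.u 0)); have b3 := hn (deriv (deriv (S.u 0)))
  have c1 := hn (S.θ 0); have c2 := hn (deriv (S.θ 0)); have c3 := hn (deriv (deriv (S.θ 0)))
  refine ⟨⟨?_, ?_⟩, ⟨?_, ?_⟩, ?_, ?_⟩
  · change L2sq (S.v 0) ≤ _; linarith
  · change L2sq (deriv (S.v 0)) ≤ _; linarith
  · change L2sq (S.u 0) ≤ _; linarith
  · change L2sq (deriv (S.u 0)) ≤ _; linarith
  · change L2sq (S.θ 0) ≤ _; linarith
  · change L2sq (deriv (S.θ 0)) ≤ _; linarith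

lemma _root_.RadHydro.SmoothPeriodic.le_two_mul {f : ℝ → ℝ → ℝ} (hf : SmoothPeriodic f)
    {M t : ℝ} (hM : 0 ≤ M) (h1 : tInt (fun x => f t x ^ 2) ≤ M ^ 2)
    (h2 : tInt (fun x => RadHydro.px f t x ^ 2) ≤ M ^ 2) (x : ℝ) : f t x ≤ 2 * M := by
  have := sq_le_tInt_sq (hf.periodic t) (hf.hasDerivAt_px t) (hf.px.continuous_slice t)
    one_pos x
  refine le_of_sq_le_sq ?_ (by linarith)
  nlinarith

/-! ### Conservation laws and entropy -/

lemma tInt_v (S : Sol μ R a b κ₁ κ₂ β γ T) {t : ℝ} (ht : t ∈ Icc 0 T) : tInt (S.v t) = 1 := by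
  rw [← S.mean_v]
  refine eq_of_deriv_eq_zero_on S.hv.hasDerivAt_tInt (fun t ht => ?_) t ht
  rw [show pt S.v t = px S.u t from funext fun x => pt_v ht x, S.hu.tInt_px]

lemma exists_energy_bound (H : Admissible μ R a b κ₁ κ₂ β γ T M ε) :
    ∃ C, 0 < C ∧ ∀ S : Sol μ R a b κ₁ κ₂ β γ T, S.Bounded M ε → ∀ t ∈ Icc 0 T,
      tInt (S.θ t) ≤ C ∧ tInt (fun x => S.u t x ^ 2) ≤ C := by
  set cv := R / (γ - 1) with hcv
  have hcv0 : 0 < cv := H.cv_pos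
  have hM := H.one_le_M
  set E := cv * (M ^ 2 + 1) / 2 + M ^ 2 / 2 with hE
  have hE0 : 0 < E := by positivity
  refine ⟨E / cv + 2 * E, by positivity, fun S hS t ht => ?_⟩
  have hs : SmoothPeriodic fun t x => cv * S.θ t x + S.u t x ^ 2 / 2 :=
    (S.hθ.const_mul cv).add ((S.hu.pow 2).div (.const 2) fun _ _ => two_pos)
  have hcons : tInt (fun x => cv * S.θ t x + S.u t x ^ 2 / 2)
      = tInt (fun x => cv * S.θ 0 x + S.u 0 x ^ 2 / 2) := by
    refine eq_of_deriv_eq_zero_on hs.hasDerivAt_tInt (fun t ht => ?_) t ht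
    have hp := (S.hflux.sub S.hq).add (S.hu.mul S.hstress)
    rw [← hp.tInt_px t]
    congr 1
    funext x
    have e1 : pt (fun t x => cv * S.θ t x + S.u t x ^ 2 / 2) t x
        = cv * pt S.θ t x + S.u t x * pt S.u t x := by
      have := ((S.hθ.hasDerivAt_pt t x).const_mul cv).add
        (((S.hu.hasDerivAt_pt t x).fun_pow 2).div_const 2)
      refine this.deriv.trans ?_
      push_cast; ring
    have e2 := (((S.hflux.hasDerivAt_px t x).sub (S.hq.hasDerivAt_px t x)).add
      ((S.hu.hasDerivAt_px t x).mul (S.hstress.hasDerivAt_px t x))).deriv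
    refine e1.trans (Eq.trans ?_ e2.symm)
    rw [energy_eq ht, pt_u ht]
    ring
  have cθ := S.hθ.continuous_slice
  have cu := S.hu.continuous_slice
  have split : ∀ t, tInt (fun x => cv * S.θ t x + S.u t x ^ 2 / 2)
      = cv * tInt (S.θ t) + tInt (fun x => S.u t x ^ 2) / 2 := fun t => by
    have h1 := cθ t
    have h2 := cu t
    rw [tInt_add (by fun_prop) (by fun_prop), tInt_const_mul]
    simp only [div_eq_mul_inv, tInt_mul_const]
  rw [split, split] at hcons
  obtain ⟨-, ⟨hu0, -⟩, hθ0, -⟩ := hS.data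
  have h1 : tInt (S.θ 0) ≤ (M ^ 2 + 1) / 2 := by
    have h1 := cθ 0
    have : tInt (fun x => 2 * S.θ 0 x) ≤ tInt fun x => S.θ 0 x ^ 2 + 1 :=
      tInt_mono (by fun_prop) (by fun_prop) fun x => by nlinarith [sq_nonneg (S.θ 0 x - 1)]
    rw [tInt_const_mul, tInt_add (by fun_prop) (by fun_prop), tInt_const] at this
    linarith
  have h2 : 0 ≤ tInt (S.θ t) := tInt_nonneg fun x => (S.θ_pos t x).le
  have h3 : 0 ≤ tInt (fun x => S.u t x ^ 2) := tInt_nonneg fun x => sq_nonneg _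
  have h4 : cv * tInt (S.θ t) + tInt (fun x => S.u t x ^ 2) / 2 ≤ E := by
    rw [hcons, hE]
    nlinarith
  have h5 := mul_nonneg hcv0.le h2
  constructor
  · have : tInt (S.θ t) ≤ E / cv := by rw [le_div_iff₀ hcv0]; linarith
    linarith
  · have : 0 ≤ E / cv := by positivity
    linarith

/-- The thermal part of the entropy dissipation. -/
def diss (S : Sol μ R a b κ₁ κ₂ β γ T) (t : ℝ) : ℝ :=
  tInt fun x => S.cond t x * px S.θ t x ^ 2 / S.θ t x ^ 2

lemma cond_pos (H : Admissible μ R a b κ₁ κ₂ β γ T M ε) (S : Sol μ R a b κ₁ κ₂ β γ T)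
    (t x : ℝ) : 0 < S.cond t x :=
  add_pos (div_pos H.κ₁_pos (S.v_pos t x)) (mul_pos H.κ₂_pos (rpow_pos_of_pos (S.θ_pos t x) _))

lemma hdiss (S : Sol μ R a b κ₁ κ₂ β γ T) :
    SmoothPeriodic fun t x => S.cond t x * px S.θ t x ^ 2 / S.θ t x ^ 2 :=
  (S.hcond.mul (S.hθ.px.pow 2)).div (S.hθ.pow 2) fun t x => pow_pos (S.θ_pos t x) 2

lemma diss_nonneg (H : Admissible μ R a b κ₁ κ₂ β γ T M ε) (S : Sol μ R a b κ₁ κ₂ β γ T)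
    (t : ℝ) : 0 ≤ S.diss t :=
  tInt_nonneg fun x => div_nonneg (mul_nonneg (S.cond_pos H t x).le (sq_nonneg _)) (sq_nonneg _)

lemma continuous_diss (S : Sol μ R a b κ₁ κ₂ β γ T) : Continuous S.diss :=
  S.hdiss.continuous_tInt

lemma diss_le_entropy_production (H : Admissible μ R a b κ₁ κ₂ β γ T M ε)
    (S : Sol μ R a b κ₁ κ₂ β γ T) {t : ℝ} (ht : t ∈ Icc 0 T) :
    S.diss t ≤ tInt (pt (fun t x => R / (γ - 1) * Real.log (S.θ t x)
      + R * Real.log (S.v t x)) t) := by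
  have one : SmoothPeriodic fun _ _ => (1 : ℝ) := .const 1
  have hinv : SmoothPeriodic fun t x => 1 / S.θ t x := one.div S.hθ S.θ_pos
  have hpt : ∀ x, pt (fun t x => R / (γ - 1) * Real.log (S.θ t x) + R * Real.log (S.v t x)) t x
      = (1 / S.θ t x * px S.flux t x - px S.q t x * (1 / S.θ t x))
        + μ * px S.u t x ^ 2 / (S.v t x * S.θ t x) := fun x => by
    have h1 := (((S.hθ.hasDerivAt_pt t x).log (S.θ_pos t x).ne').const_mul (R / (γ - 1))).add
      (((S.hv.hasDerivAt_pt t x).log (S.v_pos t x).ne').const_mul R)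
    refine h1.deriv.trans ?_
    rw [pt_v ht, ← mul_div_assoc, energy_eq ht]
    have := (S.v_pos t x).ne'
    have := (S.θ_pos t x).ne'
    simp only [stress, pressure]
    field_simp
    ring
  have hrad : 0 ≤ tInt fun x => -(px S.q t x * (1 / S.θ t x)) := by
    have h := tInt_px_q_mul_nonneg (S := S) H ht (G := fun s => -(s ^ (-(1 / 4) : ℝ)))
      (G' := fun s => -(-(1 / 4) * s ^ (-(1 / 4) - 1 : ℝ)))
      (fun s hs => (Real.hasDerivAt_rpow_const (Or.inl hs.ne')).neg)
      ((continuousOn_const.mul (continuousOn_id.rpow_const fun s hs => Or.inl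
        (ne_of_gt hs))).neg)
      (fun s hs => by have := rpow_pos_of_pos hs (-(1 / 4) - 1); linarith)
    have hb := rpow_pos_of_pos H.b_pos (-(1 / 4))
    have e : (fun x => px S.q t x * -((b * S.θ t x ^ 4) ^ (-(1 / 4) : ℝ)))
        = fun x => b ^ (-(1 / 4) : ℝ) * -(px S.q t x * (1 / S.θ t x)) := by
      funext x
      rw [Real.mul_rpow H.b_pos.le (pow_pos (S.θ_pos t x) 4).le, ← Real.rpow_natCast,
        ← Real.rpow_mul (S.θ_pos t x).le]
      norm_num [Real.rpow_neg_one]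
      ring
    rw [e, tInt_const_mul] at h
    exact nonneg_of_mul_nonneg_right h hb
  have hsum : tInt (fun x => 1 / S.θ t x * px S.flux t x + -(px S.q t x * (1 / S.θ t x)))
      ≤ tInt (pt (fun t x => R / (γ - 1) * Real.log (S.θ t x) + R * Real.log (S.v t x)) t) := by
    refine tInt_mono (((hinv.mul S.hflux.px).continuous_slice t).add
        ((S.hq.px.mul hinv).continuous_slice t).neg)
      ((((S.hθ.log S.θ_pos).const_mul _).add ((S.hv.log S.v_pos).const_mul _)).pt.continuous_slice
        t) fun x => ?_
    rw [hpt x]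
    have : 0 ≤ μ * px S.u t x ^ 2 / (S.v t x * S.θ t x) :=
      div_nonneg (mul_nonneg H.μ_pos.le (sq_nonneg _)) (mul_pos (S.v_pos t x) (S.θ_pos t x)).le
    linarith
  rw [tInt_add (g := fun x => -(px S.q t x * (1 / S.θ t x)))
    ((hinv.mul S.hflux.px).continuous_slice t) ((S.hq.px.mul hinv).continuous_slice t).neg, hinv.tInt_mul_px S.hflux] at hsum
  have hd : -tInt (fun x => px (fun t x => 1 / S.θ t x) t x * S.flux t x) = S.diss t := by
    rw [diss, ← neg_one_mul, ← tInt_const_mul]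
    congr 1
    funext x
    have h1 := ((hasDerivAt_const x (1 : ℝ)).div (S.hθ.hasDerivAt_px t x) (S.θ_pos t x).ne').deriv
    have h2 : px (fun t x => 1 / S.θ t x) t x = _ := h1
    rw [h2, flux]
    ring
  linarith

lemma exists_diss_bound (H : Admissible μ R a b κ₁ κ₂ β γ T M ε) :
    ∃ C, 0 < C ∧ ∀ S : Sol μ R a b κ₁ κ₂ β γ T, S.Bounded M ε → ∫ s in (0 : ℝ)..T, S.diss s ≤ C := by
  obtain ⟨E, hE, hen⟩ := exists_energy_bound H
  have hcv := H.cv_pos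
  set cv := R / (γ - 1) with hcvd
  have hR := H.R_pos
  have hε := H.ε_pos
  have hl : Real.log ε ≤ 0 := Real.log_nonpos hε.le H.ε_le_one
  refine ⟨cv * E + R + (cv + R) * -Real.log ε, by nlinarith [mul_pos hcv hE], fun S hS => ?_⟩
  have hT : T ∈ Icc 0 T := right_mem_Icc.2 H.T_pos.le
  have hs : SmoothPeriodic fun t x => cv * Real.log (S.θ t x) + R * Real.log (S.v t x) :=
    ((S.hθ.log S.θ_pos).const_mul _).add ((S.hv.log S.v_pos).const_mul _)
  have h := intervalIntegral_le_sub_of_le_deriv S.continuous_diss hs.hasDerivAt_tInt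
    (fun t ht => diss_le_entropy_production H S ht) T hT
  have cθ := S.hθ.continuous_slice T
  have cv' := S.hv.continuous_slice T
  have h1 : tInt (fun x => cv * Real.log (S.θ T x) + R * Real.log (S.v T x))
      ≤ tInt fun x => cv * S.θ T x + R * S.v T x := by
    refine tInt_mono (hs.continuous_slice T) (by fun_prop) fun x => ?_
    have h1 := Real.log_le_sub_one_of_pos (S.θ_pos T x)
    have h2 := Real.log_le_sub_one_of_pos (S.v_pos T x)
    nlinarith
  have h1' := tInt_add (cθ.const_mul cv) (cv'.const_mul R)
  rw [tInt_const_mul, tInt_const_mul, S.tInt_v hT] at h1'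
  have h2 : tInt (fun _ => cv * Real.log ε + R * Real.log ε)
      ≤ tInt fun x => cv * Real.log (S.θ 0 x) + R * Real.log (S.v 0 x) := by
    refine tInt_mono continuous_const (hs.continuous_slice 0) fun x => ?_
    have h1 := Real.log_le_log hε (hS.2.1 x)
    have h2 := Real.log_le_log hε (hS.2.2 x)
    nlinarith
  rw [tInt_const] at h2
  have h3 := (hen S hS T hT).1
  nlinarith

lemma θ_sq_le_cond (H : Admissible μ R a b κ₁ κ₂ β γ T M ε) (S : Sol μ R a b κ₁ κ₂ β γ T)
    (t x : ℝ) : S.θ t x ^ 2 ≤ (S.v t x / κ₁ + 1 / κ₂) * S.cond t x := by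
  have hv := S.v_pos t x
  have hθ := S.θ_pos t x
  have h1 := H.κ₁_pos
  have h2 := H.κ₂_pos
  have hp := rpow_pos_of_pos hθ β
  have e : (S.v t x / κ₁ + 1 / κ₂) * S.cond t x = 1 + S.θ t x ^ β
      + (S.v t x / κ₁ * (κ₂ * S.θ t x ^ β) + 1 / κ₂ * (κ₁ / S.v t x)) := by
    simp only [cond]; field_simp; ring
  have h3 : 0 < S.v t x / κ₁ * (κ₂ * S.θ t x ^ β) + 1 / κ₂ * (κ₁ / S.v t x) := by positivity
  rw [e]
  rcases le_total (S.θ t x) 1 with h | h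
  · nlinarith
  · have := Real.rpow_le_rpow_of_exponent_le h H.two_le_β
    rw [Real.rpow_two] at this
    linarith

lemma exists_θ_sq_bound (H : Admissible μ R a b κ₁ κ₂ β γ T M ε) :
    ∃ C, 0 < C ∧ ∀ S : Sol μ R a b κ₁ κ₂ β γ T, S.Bounded M ε → ∀ t ∈ Icc 0 T, ∀ x,
      S.θ t x ^ 2 ≤ C * (1 + S.diss t) := by
  obtain ⟨E, hE, hen⟩ := exists_energy_bound H
  have h1 := H.κ₁_pos
  have h2 := H.κ₂_pos
  set K := 1 / κ₁ + 1 / κ₂ with hK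
  have hK0 : 0 < K := by positivity
  refine ⟨(E + (1 + K)) ^ 2, by positivity, fun S hS t ht x => ?_⟩
  have hD := S.diss_nonneg H t
  set l := Real.sqrt (1 + S.diss t) with hl
  have hl2 : l ^ 2 = 1 + S.diss t := Real.sq_sqrt (by linarith)
  have hl1 : 1 ≤ l := Real.one_le_sqrt.2 (by linarith)
  have cv := S.hv.continuous_slice t
  have cd := S.hdiss.continuous_slice t
  have key : tInt (fun y => |px S.θ t y|)
      ≤ tInt fun y => 1 / l * (S.cond t y * px S.θ t y ^ 2 / S.θ t y ^ 2)
        + l * (1 / κ₁ * S.v t y + 1 / κ₂) := by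
    refine tInt_mono (S.hθ.px.continuous_slice t).abs
      ((cd.const_mul _).add (by fun_prop)) fun y => ?_
    have hθ := S.θ_pos t y
    have hc := S.cond_pos H t y
    have h3 := S.θ_sq_le_cond H t y
    set p := |px S.θ t y| with hp
    have hp2 : px S.θ t y ^ 2 = p ^ 2 := (sq_abs _).symm
    have hp0 : 0 ≤ p := abs_nonneg _
    set k := S.cond t y
    set ϑ := S.θ t y
    have h4 : ϑ ^ 2 / k ≤ 1 / κ₁ * S.v t y + 1 / κ₂ := by
      rw [div_le_iff₀ hc, one_div_mul_eq_div]; exact h3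
    have h5 : 1 / l * (k * p ^ 2 / ϑ ^ 2) + l * (ϑ ^ 2 / k) - p
        = ((k * p - l * ϑ ^ 2) ^ 2 + k * p * l * ϑ ^ 2) / (l * k * ϑ ^ 2) := by
      field_simp; ring
    have h6 : 0 ≤ ((k * p - l * ϑ ^ 2) ^ 2 + k * p * l * ϑ ^ 2) / (l * k * ϑ ^ 2) := by
      positivity
    have h7 := mul_le_mul_of_nonneg_left h4 (by linarith : 0 ≤ l)
    rw [hp2]
    linarith
  rw [tInt_add (cd.const_mul _) (by fun_prop), tInt_const_mul, tInt_const_mul,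
    tInt_add (by fun_prop) (by fun_prop), tInt_const_mul, tInt_const, S.tInt_v ht] at key
  have h3 : 1 / l * S.diss t ≤ l := by
    rw [one_div, inv_mul_le_iff₀ (by linarith)]
    nlinarith
  have h4 := le_tInt_add_tInt_abs_deriv (S.hθ.periodic t) (S.hθ.hasDerivAt_px t)
    (S.hθ.px.continuous_slice t) x
  have h5 := (hen S hS t ht).1
  have h6 : S.θ t x ≤ (E + (1 + K)) * l := by
    have : 1 / l * S.diss t + l * (1 / κ₁ * 1 + 1 / κ₂) ≤ (1 + K) * l := by
      rw [hK]; linarith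
    rw [diss] at this
    nlinarith
  rw [← hl2, ← mul_pow]
  exact pow_le_pow_left₀ (S.θ_pos t x).le h6 2

end Sol

lemma hasDerivAt_primitive {f : ℝ → ℝ} (hf : Continuous f) (t : ℝ) :
    HasDerivAt (fun t => ∫ s in (0 : ℝ)..t, f s) (f t) t :=
  intervalIntegral.integral_hasDerivAt_right (hf.intervalIntegrable _ _)
    hf.aestronglyMeasurable.stronglyMeasurableAtFilter hf.continuousAt

lemma abs_tInt_le_of_sq {f : ℝ → ℝ} (hf : Continuous f) {E : ℝ}
    (h : tInt (fun x => f x ^ 2) ≤ E) : tInt (fun x => |f x|) ≤ 1 + E := by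
  have h1 : tInt (fun x => |f x|) ≤ tInt fun x => 1 + f x ^ 2 := by
    refine tInt_mono (by fun_prop) (by fun_prop) fun x => ?_
    rw [← sq_abs (f x)]
    nlinarith [sq_nonneg (|f x| - 1), abs_nonneg (f x)]
  rw [tInt_add (by fun_prop) (by fun_prop), tInt_const] at h1
  linarith

namespace Sol

variable {μ R a b κ₁ κ₂ β γ T M ε : ℝ}

/-! ### Bounds on the specific volume -/

/-- Kazhikhov's integrating factor `exp (μ⁻¹ ∫₀ᵗ Rθ/v ds)`. -/
def factor (S : Sol μ R a b κ₁ κ₂ β γ T) (t x : ℝ) : ℝ :=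
  exp ((∫ s in (0 : ℝ)..t, S.pressure s x) / μ)

lemma hasDerivAt_factor (S : Sol μ R a b κ₁ κ₂ β γ T) (t x : ℝ) :
    HasDerivAt (fun t => S.factor t x) (S.pressure t x / μ * S.factor t x) t := by
  rw [mul_comm]
  exact ((hasDerivAt_primitive (S.hpressure.continuous_time x) t).div_const μ).exp

lemma continuous_factor (S : Sol μ R a b κ₁ κ₂ β γ T) :
    Continuous fun p : ℝ × ℝ => S.factor p.1 p.2 := by
  have h := intervalIntegral.continuous_parametric_intervalIntegral_of_continuous
    (μ := volume) (f := fun (p : ℝ × ℝ) s => S.pressure s p.2) (a₀ := 0)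
    (S.hpressure.continuous.comp (by fun_prop : Continuous fun q : (ℝ × ℝ) × ℝ => (q.2, q.1.2)))
    (s := fun p => p.1) continuous_fst
  exact Real.continuous_exp.comp (h.div_const μ)

lemma factor_pos (S : Sol μ R a b κ₁ κ₂ β γ T) (t x : ℝ) : 0 < S.factor t x := exp_pos _

lemma pressure_pos (H : Admissible μ R a b κ₁ κ₂ β γ T M ε) (S : Sol μ R a b κ₁ κ₂ β γ T)
    (t x : ℝ) : 0 < S.pressure t x :=
  div_pos (mul_pos H.R_pos (S.θ_pos t x)) (S.v_pos t x)

lemma one_le_factor (H : Admissible μ R a b κ₁ κ₂ β γ T M ε) (S : Sol μ R a b κ₁ κ₂ β γ T)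
    {t : ℝ} (ht : 0 ≤ t) (x : ℝ) : 1 ≤ S.factor t x :=
  one_le_exp (div_nonneg (intervalIntegral.integral_nonneg ht
    fun s _ => (S.pressure_pos H s x).le) H.μ_pos.le)

/-- The specific volume divided by Kazhikhov's integrating factor has bounded oscillation. -/
lemma exists_v_mul_factor_le (H : Admissible μ R a b κ₁ κ₂ β γ T M ε) :
    ∃ K, 0 < K ∧ ∀ S : Sol μ R a b κ₁ κ₂ β γ T, S.Bounded M ε → ∀ t ∈ Icc 0 T,
      ∀ x ∈ Icc (-(1 / 2) : ℝ) (1 / 2), ∀ y ∈ Icc (-(1 / 2) : ℝ) (1 / 2),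
        S.v t x * S.factor t y ≤ K * (S.v t y * S.factor t x) := by
  obtain ⟨E, hE, hen⟩ := exists_energy_bound H
  have hμ := H.μ_pos
  have hM : 0 ≤ M := by linarith [H.one_le_M]
  refine ⟨exp (Real.log (2 * M) - Real.log ε + 2 * (1 + E) / μ), exp_pos _,
    fun S hS t ht x hx y hy => ?_⟩
  have h0 : (0 : ℝ) ∈ Icc 0 T := left_mem_Icc.2 H.T_pos.le
  set N : ℝ → ℝ → ℝ := fun t x => ∫ s in (0 : ℝ)..t, S.pressure s x with hN
  have hdu : ∀ t, HasDerivAt (fun s => ∫ z in y..x, S.u s z) (∫ z in y..x, pt S.u t z) t :=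
    hasDerivAt_intervalIntegral_param _ _ S.hu.continuous_slice S.hu.pt.continuous
      S.hu.hasDerivAt_pt
  have hdl : ∀ z t, HasDerivAt (fun t => μ * Real.log (S.v t z) - N t z)
      (μ * (pt S.v t z / S.v t z) - S.pressure t z) t := fun z t =>
    (((S.hv.hasDerivAt_pt t z).log (S.v_pos t z).ne').const_mul μ).sub
      (hasDerivAt_primitive (S.hpressure.continuous_time z) t)
  have hcons := eq_of_deriv_eq_zero_on (T := T)
    (fun t => ((hdl x t).sub (hdl y t)).sub (hdu t)) (fun t ht => by
      have h1 : ∫ z in y..x, pt S.u t z = S.stress t x - S.stress t y := by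
        rw [← intervalIntegral.integral_eq_sub_of_hasDerivAt
          (fun z _ => S.hstress.hasDerivAt_px t z)
          ((S.hstress.px.continuous_slice t).intervalIntegrable _ _)]
        congr 1
        funext z
        exact pt_u ht z
      rw [h1, pt_v ht, pt_v ht]
      simp only [stress]
      ring) t ht
  simp only [Pi.sub_apply, hN, intervalIntegral.integral_same, sub_zero] at hcons
  have hub : ∀ t ∈ Icc 0 T, |∫ z in y..x, S.u t z| ≤ 1 + E := fun t ht =>
    (abs_intervalIntegral_le_tInt (S.hu.continuous_slice t) hy hx).trans
      (abs_tInt_le_of_sq (S.hu.continuous_slice t) (hen S hS t ht).2)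
  have hu1 := abs_le.1 (hub t ht)
  have hu2 := abs_le.1 (hub 0 h0)
  obtain ⟨⟨d1, d2⟩, -, -⟩ := hS.data
  have hv1 : Real.log (S.v 0 x) ≤ Real.log (2 * M) :=
    Real.log_le_log (S.v_pos 0 x) (S.hv.le_two_mul hM d1 d2 x)
  have hv2 : Real.log ε ≤ Real.log (S.v 0 y) := Real.log_le_log H.ε_pos (hS.2.1 y)
  have key : Real.log (S.v t x) + N t y / μ
      ≤ (Real.log (2 * M) - Real.log ε + 2 * (1 + E) / μ)
        + (Real.log (S.v t y) + N t x / μ) := by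
    refine le_of_mul_le_mul_left ?_ hμ
    have e1 : μ * (Real.log (S.v t x) + N t y / μ) = μ * Real.log (S.v t x) + N t y := by
      field_simp
    have e2 : μ * ((Real.log (2 * M) - Real.log ε + 2 * (1 + E) / μ)
        + (Real.log (S.v t y) + N t x / μ)) = μ * (Real.log (2 * M) - Real.log ε) + 2 * (1 + E)
        + μ * Real.log (S.v t y) + N t x := by field_simp; ring
    rw [e1, e2]
    simp only [hN]
    nlinarith
  have := exp_le_exp.2 key
  rwa [exp_add, exp_add, exp_add (Real.log (S.v t y)), exp_log (S.v_pos t x),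
    exp_log (S.v_pos t y)] at this

lemma exists_v_bound (H : Admissible μ R a b κ₁ κ₂ β γ T M ε) :
    ∃ c C, 0 < c ∧ 0 < C ∧ ∀ S : Sol μ R a b κ₁ κ₂ β γ T, S.Bounded M ε → ∀ t ∈ Icc 0 T, ∀ x,
      c ≤ S.v t x ∧ S.v t x ≤ C := by
  obtain ⟨E, hE, hen⟩ := exists_energy_bound H
  obtain ⟨L, hL, hdiss⟩ := exists_diss_bound H
  obtain ⟨Q, hQ, hθsq⟩ := exists_θ_sq_bound H
  obtain ⟨K, hK, hosc⟩ := exists_v_mul_factor_le H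
  have hμ := H.μ_pos
  have hR := H.R_pos
  have hT := H.T_pos
  set r := R * K / μ with hr
  have hr0 : 0 < r := by positivity
  set J₀ := exp (r * E * T) with hJ₀
  have hJ₀0 : 0 < J₀ := exp_pos _
  refine ⟨1 / (K * J₀), K * (1 + r * J₀ * (T + Q * (T + L))), by positivity, by positivity,
    fun S hS t ht => ?_⟩
  have cA : ∀ t, Continuous (S.factor t) := fun t =>
    S.continuous_factor.comp (by fun_prop : Continuous fun x : ℝ => (t, x))
  have cv := S.hv.continuous_slice
  set J : ℝ → ℝ := fun t => tInt (S.factor t) with hJ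
  have up : ∀ t ∈ Icc 0 T, ∀ y ∈ Icc (-(1 / 2) : ℝ) (1 / 2),
      S.factor t y ≤ K * (S.v t y * J t) := fun t ht y hy => by
    have := tInt_mono_on (f := fun x => S.v t x * S.factor t y)
      (g := fun x => K * S.v t y * S.factor t x)
      ((cv t).mul_const _) ((cA t).const_mul _) fun x hx => by
        rw [mul_assoc]; exact hosc S hS t ht x hx y hy
    rw [tInt_mul_const, tInt_const_mul, S.tInt_v ht, one_mul, mul_assoc] at this
    exact this
  have lo : ∀ t ∈ Icc 0 T, ∀ x ∈ Icc (-(1 / 2) : ℝ) (1 / 2),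
      S.v t x * J t ≤ K * S.factor t x := fun t ht x hx => by
    have := tInt_mono_on (f := fun y => S.v t x * S.factor t y)
      (g := fun y => S.v t y * (K * S.factor t x))
      ((cA t).const_mul _) ((cv t).mul_const _) fun y hy => by
        rw [mul_left_comm]; exact hosc S hS t ht x hx y hy
    rw [tInt_mul_const, tInt_const_mul, S.tInt_v ht, one_mul] at this
    exact this
  have hJ1 : ∀ t, 0 ≤ t → 1 ≤ J t := fun t ht => by
    rw [← tInt_const 1]
    exact tInt_mono continuous_const (cA t) fun x => S.one_le_factor H ht x
  have hrate : ∀ t ∈ Icc 0 T, ∀ x ∈ Icc (-(1 / 2) : ℝ) (1 / 2),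
      S.pressure t x / μ * S.factor t x ≤ r * J t * S.θ t x := fun t ht x hx => by
    have h1 := mul_le_mul_of_nonneg_left (up t ht x hx)
      (div_pos (S.pressure_pos H t x) hμ).le
    refine h1.trans (le_of_eq ?_)
    have := (S.v_pos t x).ne'
    simp only [pressure, hr]
    field_simp
  have hJd : ∀ t, HasDerivAt J (tInt fun x => S.pressure t x / μ * S.factor t x) t :=
    hasDerivAt_intervalIntegral_param _ _ cA
      ((S.hpressure.continuous.div_const μ).mul S.continuous_factor) S.hasDerivAt_factor
  have hJle : ∀ t ∈ Icc 0 T, J t ≤ J₀ := by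
    have := gronwall_dissipation (T := T) (A := r * E * T) (G := 0) (Y := 1) (y := J)
      (α := fun _ => r * E) (g := fun _ => 0) (d := fun _ => 0) hT.le
      continuous_const continuous_const continuous_const (fun _ => by positivity)
      (fun _ => le_rfl) (fun _ => le_rfl)
      (fun t => tInt_nonneg fun x => (S.factor_pos t x).le) hJd (fun t ht => ?_) ?_ ?_ ?_
    · intro t ht
      have := this t ht
      simpa using this
    · have h1 : tInt (fun x => S.pressure t x / μ * S.factor t x)
          ≤ tInt fun x => r * J t * S.θ t x :=
        tInt_mono_on (((S.hpressure.continuous_slice t).div_const _).mul (cA t))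
          ((S.hθ.continuous_slice t).const_mul _) (hrate t ht)
      rw [tInt_const_mul] at h1
      have h2 := mul_le_mul_of_nonneg_left (hen S hS t ht).1
        (mul_nonneg hr0.le (zero_le_one.trans (hJ1 t ht.1)))
      linarith
    · exact le_of_eq (by simp; ring)
    · simp
    · have : S.factor 0 = fun _ => 1 := by funext x; simp [factor]
      simp only [hJ, this, tInt_const, le_refl]
  have hfac : ∀ x ∈ Icc (-(1 / 2) : ℝ) (1 / 2),
      S.factor t x ≤ 1 + r * J₀ * (T + Q * (T + L)) := fun x hx => by
    have hd : Continuous fun t => -(r * J₀ * (1 + Q * (1 + S.diss t))) := by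
      have := S.continuous_diss
      fun_prop
    have h1 := intervalIntegral_le_sub_of_le_deriv hd
      (fun t => (S.hasDerivAt_factor t x).neg) (T := T) (fun t ht => by
        have h1 := hrate t ht x hx
        have h2 := mul_le_mul_of_nonneg_left (hJle t ht) hr0.le
        have h3 := mul_le_mul_of_nonneg_right h2 (S.θ_pos t x).le
        have h4 := hθsq S hS t ht x
        have h5 : S.θ t x ≤ 1 + S.θ t x ^ 2 := by nlinarith [sq_nonneg (S.θ t x - 1)]
        have h6 := mul_le_mul_of_nonneg_left (h5.trans (add_le_add_right h4 1))
          (mul_pos hr0 hJ₀0).le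
        linarith) t ht
    have e0 : S.factor 0 x = 1 := by simp [factor]
    simp only [Pi.neg_apply, e0] at h1
    have h2 : ∫ s in (0 : ℝ)..t, r * J₀ * (1 + Q * (1 + S.diss s))
        ≤ r * J₀ * (T + Q * (T + L)) := by
      have h3 : ∫ s in (0 : ℝ)..t, r * J₀ * (1 + Q * (1 + S.diss s))
          ≤ ∫ s in (0 : ℝ)..T, r * J₀ * (1 + Q * (1 + S.diss s)) :=
        intervalIntegral.integral_mono_interval le_rfl ht.1 ht.2
          (Filter.Eventually.of_forall fun s => by
            have := S.diss_nonneg H s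
            positivity)
          (Continuous.intervalIntegrable (by simpa using hd.fun_neg) _ _)
      refine h3.trans ?_
      have cD := S.continuous_diss.intervalIntegrable (μ := volume) 0 T
      rw [intervalIntegral.integral_const_mul, intervalIntegral.integral_add (by simp)
        ((intervalIntegrable_const.add cD).const_mul Q), intervalIntegral.integral_const_mul,
        intervalIntegral.integral_add (by simp) cD]
      have h4 : T + Q * (T + ∫ s in (0 : ℝ)..T, S.diss s) ≤ T + Q * (T + L) := by
        have := mul_le_mul_of_nonneg_left (hdiss S hS) hQ.le
        linarith
      have := mul_le_mul_of_nonneg_left h4 (mul_pos hr0 hJ₀0).le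
      simpa using this
    rw [intervalIntegral.integral_neg] at h1
    linarith
  intro x'
  obtain ⟨x, hx, e⟩ := exists_mem_Icc_eq (S.hv.periodic t) x'
  rw [e]
  have hv := S.v_pos t x
  constructor
  · have h1 := up t ht x hx
    have h2 := S.one_le_factor H ht.1 x
    have h3 := mul_le_mul_of_nonneg_left (hJle t ht) (mul_pos hK hv).le
    rw [div_le_iff₀ (by positivity)]
    linarith
  · have h1 := lo t ht x hx
    have h2 := mul_le_mul_of_nonneg_left (hJ1 t ht.1) hv.le
    have h3 := mul_le_mul_of_nonneg_left (hfac x hx) hK.le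
    linarith

end Sol

lemma SmoothPeriodic.hasDerivAt_tInt_sq {f : ℝ → ℝ → ℝ} (hf : SmoothPeriodic f) (t : ℝ) :
    HasDerivAt (fun s => tInt fun x => f s x ^ 2)
      (tInt fun x => 2 * (f t x * RadHydro.pt f t x)) t := by
  have h := (hf.pow 2).hasDerivAt_tInt t
  convert h using 2
  funext x
  refine Eq.symm (((hf.hasDerivAt_pt t x).fun_pow 2).deriv.trans ?_)
  push_cast
  ring

lemma integral_const_mul_one_add_le {D : ℝ → ℝ} (hD : Continuous D) {K T L : ℝ} (hK : 0 ≤ K)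
    (h : ∫ s in (0 : ℝ)..T, D s ≤ L) : ∫ s in (0 : ℝ)..T, K * (1 + D s) ≤ K * (T + L) := by
  rw [intervalIntegral.integral_const_mul, intervalIntegral.integral_add (by simp)
    (hD.intervalIntegrable _ _)]
  refine mul_le_mul_of_nonneg_left ?_ hK
  simpa using h

namespace Sol

variable {μ R a b κ₁ κ₂ β γ T M ε : ℝ}

/-! ### Bound on `v_x` -/

/-- The effective velocity `u - μ (log v)_x`. -/
def effVel (S : Sol μ R a b κ₁ κ₂ β γ T) (t x : ℝ) : ℝ :=
  S.u t x - μ * (px S.v t x / S.v t x)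

lemma heffVel (S : Sol μ R a b κ₁ κ₂ β γ T) : SmoothPeriodic S.effVel :=
  S.hu.sub ((S.hv.px.div S.hv S.v_pos).const_mul μ)

lemma px_stress (S : Sol μ R a b κ₁ κ₂ β γ T) (t x : ℝ) :
    px S.stress t x = μ * px (px S.u) t x / S.v t x
      - μ * px S.u t x * px S.v t x / S.v t x ^ 2 - px S.pressure t x := by
  have h := ((((S.hu.px.hasDerivAt_px t x).const_mul μ).div (S.hv.hasDerivAt_px t x)
    (S.v_pos t x).ne').sub (S.hpressure.hasDerivAt_px t x)).deriv
  refine h.trans ?_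
  have := (S.v_pos t x).ne'
  field_simp

lemma px_pressure (S : Sol μ R a b κ₁ κ₂ β γ T) (t x : ℝ) :
    px S.pressure t x = R * px S.θ t x / S.v t x
      - R * S.θ t x * px S.v t x / S.v t x ^ 2 := by
  have h := (((S.hθ.hasDerivAt_px t x).const_mul R).div (S.hv.hasDerivAt_px t x)
    (S.v_pos t x).ne').deriv
  refine h.trans ?_
  have := (S.v_pos t x).ne'
  field_simp

lemma pt_effVel (H : Admissible μ R a b κ₁ κ₂ β γ T M ε) {S : Sol μ R a b κ₁ κ₂ β γ T} {t : ℝ}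
    (ht : t ∈ Icc 0 T) (x : ℝ) : pt S.effVel t x = -(R * px S.θ t x / S.v t x)
      + R * S.θ t x / (μ * S.v t x) * (S.u t x - S.effVel t x) := by
  have h := ((S.hu.hasDerivAt_pt t x).sub (((S.hv.px.hasDerivAt_pt t x).div
    (S.hv.hasDerivAt_pt t x) (S.v_pos t x).ne').const_mul μ)).deriv
  have h1 : pt (px S.v) t x = px (px S.u) t x := by
    rw [S.hv.pt_px]
    change deriv (pt S.v t) x = deriv (px S.u t) x
    congr 1
    exact funext fun y => pt_v ht y
  refine h.trans ?_
  rw [pt_u ht, px_stress, px_pressure, h1, pt_v ht, effVel]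
  have := (S.v_pos t x).ne'
  have := H.μ_pos.ne'
  field_simp
  ring

lemma tInt_px_θ_sq_le (H : Admissible μ R a b κ₁ κ₂ β γ T M ε) (S : Sol μ R a b κ₁ κ₂ β γ T)
    {t C : ℝ} (hC : ∀ x, S.v t x ≤ C) :
    tInt (fun x => px S.θ t x ^ 2) ≤ (C / κ₁ + 1 / κ₂) * S.diss t := by
  rw [diss, ← tInt_const_mul]
  have c1 := S.hθ.px.continuous_slice t
  refine tInt_mono (by fun_prop) ((S.hdiss.continuous_slice t).const_mul _) fun x => ?_
  have h1 := S.θ_sq_le_cond H t x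
  have h2 : S.v t x / κ₁ + 1 / κ₂ ≤ C / κ₁ + 1 / κ₂ := by
    have := H.κ₁_pos
    have := hC x
    gcongr
  have h3 := h1.trans (mul_le_mul_of_nonneg_right h2 (S.cond_pos H t x).le)
  have hθ := pow_pos (S.θ_pos t x) 2
  rw [mul_div_assoc', le_div_iff₀ hθ]
  have := mul_le_mul_of_nonneg_left h3 (sq_nonneg (px S.θ t x))
  linarith

lemma exists_effVel_bound (H : Admissible μ R a b κ₁ κ₂ β γ T M ε) :
    ∃ C, 0 < C ∧ ∀ S : Sol μ R a b κ₁ κ₂ β γ T, S.Bounded M ε → ∀ t ∈ Icc 0 T,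
      tInt (fun x => S.effVel t x ^ 2) ≤ C := by
  obtain ⟨E, hE, hen⟩ := exists_energy_bound H
  obtain ⟨L, hL, hdiss⟩ := exists_diss_bound H
  obtain ⟨Q, hQ, hθsq⟩ := exists_θ_sq_bound H
  obtain ⟨c, C, hc, hC, hvb⟩ := exists_v_bound H
  have hμ := H.μ_pos
  have hR := H.R_pos
  have hT := H.T_pos
  have hε := H.ε_pos
  have h1 := H.κ₁_pos
  have h2 := H.κ₂_pos
  set K := R ^ 2 / c ^ 2 * (C / κ₁ + 1 / κ₂) + R / (μ * c) * (1 + Q) * E with hK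
  have hK0 : 0 < K := by positivity
  refine ⟨exp T * ((2 * M ^ 2 + 2 * (μ / ε) ^ 2 * M ^ 2) + K * (T + L)), ?_, fun S hS t ht => ?_⟩
  · have := H.one_le_M
    positivity
  have h := gronwall_dissipation (T := T) (A := T) (G := K * (T + L))
      (Y := 2 * M ^ 2 + 2 * (μ / ε) ^ 2 * M ^ 2)
      (y := fun t => tInt fun x => S.effVel t x ^ 2)
      (α := fun _ => 1) (g := fun t => K * (1 + S.diss t)) (d := fun _ => 0) hT.le
      continuous_const (by have := S.continuous_diss; fun_prop) continuous_const
      (fun _ => zero_le_one) (fun t => by have := S.diss_nonneg H t; positivity)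
      (fun _ => le_rfl)
      (fun t => tInt_nonneg fun x => sq_nonneg _) S.heffVel.hasDerivAt_tInt_sq
      (fun t ht => ?_) (by simp) (integral_const_mul_one_add_le S.continuous_diss hK0.le
        (hdiss S hS)) ?_ t ht
  · simpa using h
  · have cω := S.heffVel.continuous_slice t
    have cω' := S.heffVel.pt.continuous_slice t
    have cu := S.hu.continuous_slice t
    have cθ := S.hθ.px.continuous_slice t
    have hD := S.diss_nonneg H t
    have key : tInt (fun x => 2 * (S.effVel t x * pt S.effVel t x))
        ≤ tInt fun x => S.effVel t x ^ 2 + (R ^ 2 / c ^ 2 * px S.θ t x ^ 2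
          + R / (μ * c) * ((1 + Q) * (1 + S.diss t)) * S.u t x ^ 2) := by
      refine tInt_mono (by fun_prop) (by fun_prop) fun x => ?_
      have hv := S.v_pos t x
      have hθ := S.θ_pos t x
      have hvc := (hvb S hS t ht x).1
      rw [pt_effVel H ht]
      set ω := S.effVel t x
      set w := S.u t x
      set p := px S.θ t x
      have e1 : 2 * (ω * -(R * p / S.v t x)) ≤ ω ^ 2 + R ^ 2 / c ^ 2 * p ^ 2 := by
        have i1 : R ^ 2 * p ^ 2 / S.v t x ^ 2 ≤ R ^ 2 * p ^ 2 / c ^ 2 := by gcongr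
        have i2 : R ^ 2 * p ^ 2 / S.v t x ^ 2 = (R * p / S.v t x) ^ 2 := by ring
        have i3 : R ^ 2 / c ^ 2 * p ^ 2 = R ^ 2 * p ^ 2 / c ^ 2 := by ring
        nlinarith [sq_nonneg (ω + R * p / S.v t x)]
      have e2 : R * S.θ t x / (μ * S.v t x) ≤ R / (μ * c) * ((1 + Q) * (1 + S.diss t)) := by
        have i1 : S.θ t x ≤ (1 + Q) * (1 + S.diss t) := by
          nlinarith [hθsq S hS t ht x, sq_nonneg (S.θ t x - 1)]
        have i2 : R * S.θ t x / (μ * S.v t x)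
            ≤ R * ((1 + Q) * (1 + S.diss t)) / (μ * c) := by gcongr
        exact i2.trans (le_of_eq (by ring))
      have e3 : 2 * ω * (w - ω) ≤ w ^ 2 := by nlinarith [sq_nonneg (w - ω), sq_nonneg ω]
      have e4 : 0 ≤ R * S.θ t x / (μ * S.v t x) := by positivity
      have e5 := mul_le_mul_of_nonneg_left e3 e4
      have e6 := mul_le_mul_of_nonneg_right e2 (sq_nonneg w)
      linarith
    rw [tInt_add (by fun_prop) (by fun_prop), tInt_add (by fun_prop) (by fun_prop),
      tInt_const_mul (R ^ 2 / c ^ 2), tInt_const_mul (R / (μ * c) * _)] at key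
    have k1 := mul_le_mul_of_nonneg_left
      (S.tInt_px_θ_sq_le H fun x => (hvb S hS t ht x).2) (by positivity : 0 ≤ R ^ 2 / c ^ 2)
    have k2 := mul_le_mul_of_nonneg_left (hen S hS t ht).2
      (by positivity : 0 ≤ R / (μ * c) * ((1 + Q) * (1 + S.diss t)))
    have k3 : 0 ≤ R ^ 2 / c ^ 2 * (C / κ₁ + 1 / κ₂) := by positivity
    rw [hK]
    linarith
  · obtain ⟨⟨-, d2⟩, ⟨d3, -⟩, -⟩ := hS.data
    have cω := S.heffVel.continuous_slice 0
    have cu := S.hu.continuous_slice 0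
    have cv := S.hv.px.continuous_slice 0
    have key : tInt (fun x => S.effVel 0 x ^ 2)
        ≤ tInt fun x => 2 * S.u 0 x ^ 2 + 2 * (μ / ε) ^ 2 * px S.v 0 x ^ 2 := by
      refine tInt_mono (by fun_prop) (by fun_prop) fun x => ?_
      have hv := S.v_pos 0 x
      have hvε := hS.2.1 x
      have i1 : μ ^ 2 * px S.v 0 x ^ 2 / S.v 0 x ^ 2 ≤ μ ^ 2 * px S.v 0 x ^ 2 / ε ^ 2 := by
        gcongr
      have i2 : 2 * (μ / ε) ^ 2 * px S.v 0 x ^ 2 = 2 * (μ ^ 2 * px S.v 0 x ^ 2 / ε ^ 2) := by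
        ring
      have i3 : μ ^ 2 * px S.v 0 x ^ 2 / S.v 0 x ^ 2 = (μ * (px S.v 0 x / S.v 0 x)) ^ 2 := by
        ring
      rw [i2, effVel]
      nlinarith [sq_nonneg (S.u 0 x + μ * (px S.v 0 x / S.v 0 x))]
    rw [tInt_add (by fun_prop) (by fun_prop), tInt_const_mul, tInt_const_mul] at key
    have := mul_le_mul_of_nonneg_left d2 (by positivity : 0 ≤ 2 * (μ / ε) ^ 2)
    linarith

lemma exists_px_v_bound (H : Admissible μ R a b κ₁ κ₂ β γ T M ε) :
    ∃ C, 0 < C ∧ ∀ S : Sol μ R a b κ₁ κ₂ β γ T, S.Bounded M ε → ∀ t ∈ Icc 0 T,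
      tInt (fun x => px S.v t x ^ 2) ≤ C := by
  obtain ⟨E, hE, hen⟩ := exists_energy_bound H
  obtain ⟨c, V, hc, hV, hvb⟩ := exists_v_bound H
  obtain ⟨W, hW, hω⟩ := exists_effVel_bound H
  have hμ := H.μ_pos
  refine ⟨(V / μ) ^ 2 * (2 * E + 2 * W), by positivity, fun S hS t ht => ?_⟩
  have cω := S.heffVel.continuous_slice t
  have cu := S.hu.continuous_slice t
  have cv := S.hv.px.continuous_slice t
  have key : tInt (fun x => px S.v t x ^ 2)
      ≤ tInt fun x => (V / μ) ^ 2 * (2 * S.u t x ^ 2 + 2 * S.effVel t x ^ 2) := by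
    refine tInt_mono (by fun_prop) (by fun_prop) fun x => ?_
    have hv := S.v_pos t x
    have e : px S.v t x = S.v t x / μ * (S.u t x - S.effVel t x) := by
      rw [effVel]; field_simp; ring
    rw [e, mul_pow]
    have h1 : (S.v t x / μ) ^ 2 ≤ (V / μ) ^ 2 := by
      have := (hvb S hS t ht x).2
      gcongr
    refine mul_le_mul h1 ?_ (sq_nonneg _) (sq_nonneg _)
    nlinarith [sq_nonneg (S.u t x + S.effVel t x)]
  rw [tInt_const_mul, tInt_add (by fun_prop) (by fun_prop), tInt_const_mul,
    tInt_const_mul] at key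
  refine key.trans (mul_le_mul_of_nonneg_left ?_ (sq_nonneg _))
  linarith [hω S hS t ht, (hen S hS t ht).2]

end Sol

/-- The pointwise estimate of `-2 u_xx σ_x`, where `σ` is the stress. -/
lemma neg_two_mul_stress_le {μ R c C v w p z q θ N Θ : ℝ} (hμ : 0 < μ) (hR : 0 < R) (hc : 0 < c)
    (hvc : c ≤ v) (hvC : v ≤ C) (hp : p ^ 2 ≤ N) (hθ : θ ^ 2 ≤ Θ) :
    -2 * (w * (μ * w / v - μ * p * z / v ^ 2 - (R * q / v - R * θ * z / v ^ 2)))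
      ≤ (3 * C / μ * (μ ^ 2 / c ^ 4) * N + 3 * C / μ * (R ^ 2 / c ^ 4) * Θ) * z ^ 2
        + (3 * C / μ * (R ^ 2 / c ^ 2) * q ^ 2 + -(μ / C) * w ^ 2) := by
  have hv : 0 < v := hc.trans_le hvc
  have hC : 0 < C := hv.trans_le hvC
  have hN : 0 ≤ N := (sq_nonneg _).trans hp
  have hΘ : 0 ≤ Θ := (sq_nonneg _).trans hθ
  set r := μ * p * z / v ^ 2 + (R * q / v - R * θ * z / v ^ 2) with hr
  have i1 : -2 * (w * (μ * w / v - μ * p * z / v ^ 2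
      - (R * q / v - R * θ * z / v ^ 2))) ≤ -(μ / v) * w ^ 2 + v / μ * r ^ 2 := by
    have e : -(μ / v) * w ^ 2 + v / μ * r ^ 2 - -2 * (w * (μ * w / v - μ * p * z / v ^ 2
      - (R * q / v - R * θ * z / v ^ 2))) = (μ * w - v * r) ^ 2 / (μ * v) := by
      rw [sub_sub, ← hr]; field_simp; ring
    have : 0 ≤ (μ * w - v * r) ^ 2 / (μ * v) := by positivity
    linarith
  have i2 : r ^ 2 ≤ 3 * (μ ^ 2 * (p ^ 2 * z ^ 2) / v ^ 4 + R ^ 2 * q ^ 2 / v ^ 2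
      + R ^ 2 * (θ ^ 2 * z ^ 2) / v ^ 4) := by
    have e1 : μ ^ 2 * (p ^ 2 * z ^ 2) / v ^ 4 = (μ * p * z / v ^ 2) ^ 2 := by ring
    have e2 : R ^ 2 * q ^ 2 / v ^ 2 = (R * q / v) ^ 2 := by ring
    have e3 : R ^ 2 * (θ ^ 2 * z ^ 2) / v ^ 4 = (R * θ * z / v ^ 2) ^ 2 := by ring
    rw [e1, e2, e3, hr]
    generalize μ * p * z / v ^ 2 = α
    generalize R * q / v = β
    generalize R * θ * z / v ^ 2 = δ
    linarith [sq_nonneg (α - β), sq_nonneg (α + δ), sq_nonneg (β + δ)]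
  have i3 : μ ^ 2 * (p ^ 2 * z ^ 2) / v ^ 4 + R ^ 2 * q ^ 2 / v ^ 2
      + R ^ 2 * (θ ^ 2 * z ^ 2) / v ^ 4
      ≤ μ ^ 2 * (N * z ^ 2) / c ^ 4 + R ^ 2 * q ^ 2 / c ^ 2 + R ^ 2 * (Θ * z ^ 2) / c ^ 4 := by
    gcongr
  have i4 : v / μ * r ^ 2 ≤ C / μ * (3 * (μ ^ 2 * (N * z ^ 2) / c ^ 4 + R ^ 2 * q ^ 2 / c ^ 2
      + R ^ 2 * (Θ * z ^ 2) / c ^ 4)) :=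
    mul_le_mul (by gcongr) (by linarith) (sq_nonneg _) (by positivity)
  have i5 : C / μ * (3 * (μ ^ 2 * (N * z ^ 2) / c ^ 4 + R ^ 2 * q ^ 2 / c ^ 2
      + R ^ 2 * (Θ * z ^ 2) / c ^ 4))
      = (3 * C / μ * (μ ^ 2 / c ^ 4) * N + 3 * C / μ * (R ^ 2 / c ^ 4) * Θ) * z ^ 2
        + 3 * C / μ * (R ^ 2 / c ^ 2) * q ^ 2 := by
    ring
  have i6 : μ / C * w ^ 2 ≤ μ / v * w ^ 2 := by gcongr
  linarith

namespace Sol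

variable {μ R a b κ₁ κ₂ β γ T M ε : ℝ}

/-! ### Bound on `u_x` -/

lemma exists_px_u_bound (H : Admissible μ R a b κ₁ κ₂ β γ T M ε) :
    ∃ C, 0 < C ∧ ∀ S : Sol μ R a b κ₁ κ₂ β γ T, S.Bounded M ε → ∀ t ∈ Icc 0 T,
      tInt (fun x => px S.u t x ^ 2) ≤ C ∧
        ∫ s in (0 : ℝ)..t, tInt (fun x => px (px S.u) s x ^ 2) ≤ C := by
  obtain ⟨L, hL, hdiss⟩ := exists_diss_bound H
  obtain ⟨Q, hQ, hθsq⟩ := exists_θ_sq_bound H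
  obtain ⟨c, C, hc, hC, hvb⟩ := exists_v_bound H
  obtain ⟨W, hW, hvx⟩ := exists_px_v_bound H
  have hμ := H.μ_pos
  have hR := H.R_pos
  have hT := H.T_pos
  have h1 := H.κ₁_pos
  have h2 := H.κ₂_pos
  set A₁ := 3 * C / μ * (μ ^ 2 / c ^ 4) with hA₁
  set A₂ := 3 * C / μ * (R ^ 2 / c ^ 2) with hA₂
  set A₃ := 3 * C / μ * (R ^ 2 / c ^ 4) with hA₃
  have hA₁0 : 0 < A₁ := by positivity
  have hA₂0 : 0 < A₂ := by positivity
  have hA₃0 : 0 < A₃ := by positivity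
  set η := μ / (2 * C) / (A₁ * W) with hη
  have hη0 : 0 < η := by positivity
  have hηe : A₁ * W * η = μ / (2 * C) := by rw [hη]; field_simp
  set A := A₁ * W * (1 + 1 / η) with hA
  have hA0 : 0 < A := by positivity
  set K := A₂ * (C / κ₁ + 1 / κ₂) + A₃ * Q * W with hK
  have hK0 : 0 < K := by positivity
  set B := exp (A * T) * (M ^ 2 + K * (T + L)) with hB
  have hB0 : 0 < B := by
    have := H.one_le_M
    positivity
  refine ⟨B + 2 * C / μ * B, by positivity, fun S hS t ht => ?_⟩
  have hdw := (S.hu.px.px.pow 2).continuous_tInt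
  have h := gronwall_dissipation (T := T) (A := A * T) (G := K * (T + L)) (Y := M ^ 2)
      (y := fun t => tInt fun x => px S.u t x ^ 2)
      (α := fun _ => A) (g := fun t => K * (1 + S.diss t))
      (d := fun t => μ / (2 * C) * tInt fun x => px (px S.u) t x ^ 2) hT.le
      continuous_const (by have := S.continuous_diss; fun_prop) (hdw.const_mul _)
      (fun _ => hA0.le) (fun t => by have := S.diss_nonneg H t; positivity)
      (fun t => mul_nonneg (by positivity) (tInt_nonneg fun x => sq_nonneg _))
      (fun t => tInt_nonneg fun x => sq_nonneg _) S.hu.px.hasDerivAt_tInt_sq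
      (fun t ht => ?_) (by simp [mul_comm]) (integral_const_mul_one_add_le S.continuous_diss hK0.le
        (hdiss S hS)) hS.data.2.1.2 t ht
  · rw [intervalIntegral.integral_const_mul] at h
    have n1 : 0 ≤ tInt (fun x => px S.u t x ^ 2) := tInt_nonneg fun x => sq_nonneg _
    have n2 : 0 ≤ ∫ s in (0 : ℝ)..t, tInt (fun x => px (px S.u) s x ^ 2) :=
      intervalIntegral.integral_nonneg ht.1 fun s _ => tInt_nonneg fun x => sq_nonneg _
    have n3 : 0 ≤ 2 * C / μ * B := by positivity
    have n4 : 0 ≤ μ / (2 * C) := by positivity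
    have n5 := mul_nonneg n4 n2
    refine ⟨by linarith, ?_⟩
    have h' : μ / (2 * C) * (∫ s in (0 : ℝ)..t, tInt (fun x => px (px S.u) s x ^ 2)) ≤ B := by
      linarith
    have := mul_le_mul_of_nonneg_left h' (by positivity : 0 ≤ 2 * C / μ)
    have e : ∀ z, 2 * C / μ * (μ / (2 * C) * z) = z := fun z => by field_simp
    rw [e] at this
    linarith
  · have cp := S.hu.px.continuous_slice t
    have cw := S.hu.px.px.continuous_slice t
    have cz := S.hv.px.continuous_slice t
    have cθ := S.hθ.px.continuous_slice t
    have cs := S.hstress.px.continuous_slice t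
    have hD := S.diss_nonneg H t
    have e1 : tInt (fun x => 2 * (px S.u t x * pt (px S.u) t x))
        = tInt fun x => -2 * (px (px S.u) t x * px S.stress t x) := by
      rw [tInt_const_mul, tInt_const_mul]
      have : (fun x => px S.u t x * pt (px S.u) t x)
          = fun x => px S.u t x * px (pt S.u) t x := by
        funext x; rw [S.hu.pt_px]
      rw [this, S.hu.px.tInt_mul_px S.hu.pt]
      have : (fun x => px (px S.u) t x * pt S.u t x)
          = fun x => px (px S.u) t x * px S.stress t x := by
        funext x; rw [pt_u ht]
      rw [this]
      ring
    set N := (1 + 1 / η) * tInt (fun y => px S.u t y ^ 2)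
      + η * tInt fun y => px (px S.u) t y ^ 2 with hN
    have hsup : ∀ x, px S.u t x ^ 2 ≤ N := fun x =>
      sq_le_tInt_sq (S.hu.px.periodic t) (S.hu.px.hasDerivAt_px t) cw hη0 x
    have hN0 : 0 ≤ N := (sq_nonneg _).trans (hsup 0)
    have key : tInt (fun x => -2 * (px (px S.u) t x * px S.stress t x))
        ≤ tInt fun x => (A₁ * N + A₃ * (Q * (1 + S.diss t))) * px S.v t x ^ 2
          + (A₂ * px S.θ t x ^ 2 + -(μ / C) * px (px S.u) t x ^ 2) := by
      refine tInt_mono (by fun_prop) (by fun_prop) fun x => ?_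
      obtain ⟨hvc, hvC⟩ := hvb S hS t ht x
      rw [px_stress, px_pressure]
      exact neg_two_mul_stress_le hμ hR hc hvc hvC (hsup x) (hθsq S hS t ht x)
    rw [tInt_add (by fun_prop) (by fun_prop), tInt_add (by fun_prop) (by fun_prop),
      tInt_const_mul (A₁ * N + _), tInt_const_mul A₂, tInt_const_mul (-(μ / C))] at key
    have k1 := mul_le_mul_of_nonneg_left
      (S.tInt_px_θ_sq_le H fun x => (hvb S hS t ht x).2) hA₂0.le
    have k2 := mul_le_mul_of_nonneg_left (hvx S hS t ht)
      (by positivity : 0 ≤ A₁ * N + A₃ * (Q * (1 + S.diss t)))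
    have k3 : 0 ≤ A₂ * (C / κ₁ + 1 / κ₂) := by positivity
    have k4 : A₁ * N * W = A * tInt (fun y => px S.u t y ^ 2)
        + μ / (2 * C) * tInt fun y => px (px S.u) t y ^ 2 := by
      rw [← hηe, hN, hA]; ring
    have k5 : μ / C = 2 * (μ / (2 * C)) := by field_simp
    rw [e1, hK]
    rw [k5] at key
    linarith

/-- An integrable-in-time majorant of `sup u_x²`. -/
def strain (S : Sol μ R a b κ₁ κ₂ β γ T) (t : ℝ) : ℝ :=
  2 * tInt (fun x => px S.u t x ^ 2) + tInt fun x => px (px S.u) t x ^ 2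

lemma continuous_strain (S : Sol μ R a b κ₁ κ₂ β γ T) : Continuous S.strain :=
  ((S.hu.px.pow 2).continuous_tInt.const_mul 2).add (S.hu.px.px.pow 2).continuous_tInt

lemma px_u_sq_le_strain (S : Sol μ R a b κ₁ κ₂ β γ T) (t x : ℝ) :
    px S.u t x ^ 2 ≤ S.strain t := by
  have := sq_le_tInt_sq (S.hu.px.periodic t) (S.hu.px.hasDerivAt_px t)
    (S.hu.px.px.continuous_slice t) one_pos x
  rw [strain]
  linarith

lemma strain_nonneg (S : Sol μ R a b κ₁ κ₂ β γ T) (t : ℝ) : 0 ≤ S.strain t :=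
  (sq_nonneg _).trans (S.px_u_sq_le_strain t 0)

lemma exists_strain_bound (H : Admissible μ R a b κ₁ κ₂ β γ T M ε) :
    ∃ C, 0 < C ∧ ∀ S : Sol μ R a b κ₁ κ₂ β γ T, S.Bounded M ε →
      ∫ s in (0 : ℝ)..T, S.strain s ≤ C := by
  obtain ⟨C, hC, h⟩ := exists_px_u_bound H
  have hT := H.T_pos
  refine ⟨T * (2 * C) + C, by positivity, fun S hS => ?_⟩
  have c1 := (S.hu.px.pow 2).continuous_tInt
  have c2 := (S.hu.px.px.pow 2).continuous_tInt
  have e : ∫ s in (0 : ℝ)..T, S.strain s = (∫ s in (0 : ℝ)..T, 2 * tInt fun x => px S.u s x ^ 2)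
      + ∫ s in (0 : ℝ)..T, tInt fun x => px (px S.u) s x ^ 2 :=
    intervalIntegral.integral_add ((c1.const_mul 2).intervalIntegrable _ _)
      (c2.intervalIntegrable _ _)
  have h1 : ∫ s in (0 : ℝ)..T, 2 * tInt (fun x => px S.u s x ^ 2)
      ≤ ∫ _ in (0 : ℝ)..T, 2 * C :=
    intervalIntegral.integral_mono_on hT.le ((c1.const_mul 2).intervalIntegrable _ _)
      (by simp) fun s hs => by linarith [(h S hS s hs).1]
  rw [intervalIntegral.integral_const, sub_zero, smul_eq_mul] at h1
  rw [e]
  linarith [(h S hS T ⟨hT.le, le_rfl⟩).2]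

/-! ### Bound on the temperature -/

lemma tInt_px_q_mul_pow_nonneg (H : Admissible μ R a b κ₁ κ₂ β γ T M ε)
    (S : Sol μ R a b κ₁ κ₂ β γ T) {t : ℝ} (ht : t ∈ Icc 0 T) (n : ℕ) :
    0 ≤ tInt fun x => px S.q t x * (1 + S.θ t x) ^ n := by
  have hb := H.b_pos
  have h := tInt_px_q_mul_nonneg H ht (S := S)
    (G := fun s => (1 + (s / b) ^ (1 / 4 : ℝ)) ^ n)
    (G' := fun s => n * (1 + (s / b) ^ (1 / 4 : ℝ)) ^ (n - 1)
      * (1 / b * (1 / 4 : ℝ) * (s / b) ^ (1 / 4 - 1 : ℝ)))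
    (fun s hs => ?_) ?_ (fun s hs => ?_)
  · convert h using 4 with x
    have : (S.θ t x ^ 4) ^ (1 / 4 : ℝ) = S.θ t x := by
      rw [← Real.rpow_natCast, ← Real.rpow_mul (S.θ_pos t x).le]
      norm_num
    rw [mul_div_cancel_left₀ _ hb.ne', this]
  · have hsb : s / b ≠ 0 := (div_pos hs hb).ne'
    exact ((((hasDerivAt_id s).div_const b).rpow_const (p := (1 / 4 : ℝ))
      (Or.inl hsb)).const_add 1).fun_pow n
  · have hsb : ∀ s ∈ Ioi (0 : ℝ), s / b ≠ 0 := fun s hs => (div_pos hs hb).ne'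
    have c1 : ∀ r : ℝ, ContinuousOn (fun s => (s / b) ^ r) (Ioi 0) := fun r =>
      (continuous_id.div_const b).continuousOn.rpow_const fun s hs => Or.inl (hsb s hs)
    exact (continuousOn_const.mul ((continuousOn_const.add (c1 _)).pow _)).mul
      (continuousOn_const.mul (c1 _))
  · have := div_pos hs hb
    positivity

lemma tInt_pow_mul_px_flux_nonpos (H : Admissible μ R a b κ₁ κ₂ β γ T M ε)
    (S : Sol μ R a b κ₁ κ₂ β γ T) (t : ℝ) (n : ℕ) :
    tInt (fun x => (1 + S.θ t x) ^ n * px S.flux t x) ≤ 0 := by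
  have hψ : SmoothPeriodic fun t x => (1 + S.θ t x) ^ n := ((SmoothPeriodic.const 1).add S.hθ).pow n
  rw [hψ.tInt_mul_px S.hflux, neg_nonpos]
  refine tInt_nonneg fun x => ?_
  have h : px (fun t x => (1 + S.θ t x) ^ n) t x
      = n * (1 + S.θ t x) ^ (n - 1) * px S.θ t x :=
    (((S.hθ.hasDerivAt_px t x).const_add 1).fun_pow n).deriv
  rw [h, flux]
  have h1 := S.cond_pos H t x
  have h2 := S.θ_pos t x
  have : n * (1 + S.θ t x) ^ (n - 1) * px S.θ t x * (S.cond t x * px S.θ t x)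
      = n * (1 + S.θ t x) ^ (n - 1) * S.cond t x * px S.θ t x ^ 2 := by ring
  rw [this]
  positivity

lemma stress_mul_px_u_le (H : Admissible μ R a b κ₁ κ₂ β γ T M ε) (S : Sol μ R a b κ₁ κ₂ β γ T)
    {t x c : ℝ} (hc : 0 < c) (hv : c ≤ S.v t x) :
    S.stress t x * px S.u t x ≤ (μ + R) / c * (1 + S.strain t) * (1 + S.θ t x) := by
  have hμ := H.μ_pos
  have hR := H.R_pos
  have hm := S.strain_nonneg t
  have hp := S.px_u_sq_le_strain t x
  have hθ := S.θ_pos t x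
  have hv0 := S.v_pos t x
  have hneg : -px S.u t x ≤ 1 + S.strain t := by nlinarith [sq_nonneg (px S.u t x + 1)]
  have e : S.stress t x * px S.u t x
      = (μ * px S.u t x ^ 2 + R * S.θ t x * -px S.u t x) / S.v t x := by
    rw [stress, pressure]; field_simp; ring
  rw [e]
  have h1 : μ * px S.u t x ^ 2 + R * S.θ t x * -px S.u t x
      ≤ (μ + R) * (1 + S.strain t) * (1 + S.θ t x) := by
    have h2 := mul_le_mul_of_nonneg_left hp hμ.le
    have h3 := mul_le_mul_of_nonneg_left hneg (mul_pos hR hθ).le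
    have h4 : 0 ≤ μ * (1 + S.θ t x + S.strain t * S.θ t x) + R * (1 + S.strain t) := by
      positivity
    linarith
  have h0 : 0 ≤ (μ + R) * (1 + S.strain t) * (1 + S.θ t x) := by positivity
  calc _ ≤ ((μ + R) * (1 + S.strain t) * (1 + S.θ t x)) / S.v t x := by gcongr
    _ ≤ ((μ + R) * (1 + S.strain t) * (1 + S.θ t x)) / c := by gcongr
    _ = _ := by ring

lemma exists_θ_bound (H : Admissible μ R a b κ₁ κ₂ β γ T M ε) :
    ∃ C, 0 < C ∧ ∀ S : Sol μ R a b κ₁ κ₂ β γ T, S.Bounded M ε → ∀ t ∈ Icc 0 T, ∀ x,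
      S.θ t x ≤ C := by
  obtain ⟨c, V, hc, hV, hvb⟩ := exists_v_bound H
  obtain ⟨m, hm, hstr⟩ := exists_strain_bound H
  have hμ := H.μ_pos
  have hR := H.R_pos
  have hT := H.T_pos
  have hcv := H.cv_pos
  have hM : 0 < 1 + 2 * M := by linarith [H.one_le_M]
  set cv := R / (γ - 1) with hcvd
  set K := (μ + R) / c / cv with hK
  have hK0 : 0 < K := by positivity
  have hKe : cv * K = (μ + R) / c := by rw [hK]; field_simp
  refine ⟨exp (K * (T + m)) * (1 + 2 * M), by positivity, fun S hS t ht x => ?_⟩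
  have hψ : SmoothPeriodic fun t x => 1 + S.θ t x := (SmoothPeriodic.const 1).add S.hθ
  have hψ0 : ∀ t x, 0 ≤ 1 + S.θ t x := fun t x => by linarith [S.θ_pos t x]
  refine le_trans (by linarith) (le_of_tInt_pow_le (hψ.continuous_slice t) (hψ.periodic t) (hψ0 t)
    (B := exp (K * (T + m)) * (1 + 2 * M)) (by positivity) (fun n => ?_) x)
  have cs := S.continuous_strain
  have h := gronwall_dissipation (T := T) (A := (n + 1) * K * (T + m)) (G := 0)
      (Y := (1 + 2 * M) ^ (n + 1))
      (y := fun t => tInt fun x => (1 + S.θ t x) ^ (n + 1))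
      (α := fun t => (n + 1) * K * (1 + S.strain t)) (g := fun _ => 0) (d := fun _ => 0) hT.le
      (by fun_prop) continuous_const continuous_const
      (fun t => by have := S.strain_nonneg t; positivity) (fun _ => le_rfl) (fun _ => le_rfl)
      (fun t => tInt_nonneg fun x => pow_nonneg (hψ0 t x) _) (hψ.pow (n + 1)).hasDerivAt_tInt
      (fun t ht => ?_) (integral_const_mul_one_add_le cs (by positivity) (hstr S hS)) (by simp)
      ?_ t ht
  · have e : (exp (K * (T + m)) * (1 + 2 * M)) ^ (n + 1)
        = exp ((n + 1) * K * (T + m)) * ((1 + 2 * M) ^ (n + 1) + 0) := by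
      rw [mul_pow, ← Real.exp_nat_mul, add_zero]
      push_cast
      ring_nf
    rw [e]
    simpa using h
  · have cθ := S.hθ.continuous_slice t
    have cF := S.hflux.px.continuous_slice t
    have cq := S.hq.px.continuous_slice t
    have cS := S.hstress.continuous_slice t
    have cu := S.hu.px.continuous_slice t
    have e1 : tInt (pt (fun t x => (1 + S.θ t x) ^ (n + 1)) t)
        = (n + 1) / cv * (tInt (fun x => (1 + S.θ t x) ^ n * px S.flux t x)
          - tInt (fun x => px S.q t x * (1 + S.θ t x) ^ n)
          + tInt fun x => (1 + S.θ t x) ^ n * (S.stress t x * px S.u t x)) := by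
      rw [← tInt_sub (by fun_prop) (by fun_prop), ← tInt_add (by fun_prop) (by fun_prop),
        ← tInt_const_mul]
      congr 1
      funext x
      have h1 : pt (fun t x => (1 + S.θ t x) ^ (n + 1)) t x
          = (n + 1) * (1 + S.θ t x) ^ n * pt S.θ t x := by
        refine (((S.hθ.hasDerivAt_pt t x).const_add 1).fun_pow (n + 1)).deriv.trans ?_
        push_cast
        simp
      have h2 := energy_eq (S := S) ht x
      rw [← hcvd] at h2
      have h3 : pt S.θ t x = (px S.flux t x - px S.q t x + S.stress t x * px S.u t x) / cv := by
        rw [← h2]; field_simp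
      rw [h1, h3]
      ring
    have k1 := S.tInt_pow_mul_px_flux_nonpos H t n
    have k2 := S.tInt_px_q_mul_pow_nonneg H ht n
    have k3 : tInt (fun x => (1 + S.θ t x) ^ n * (S.stress t x * px S.u t x))
        ≤ tInt fun x => (μ + R) / c * (1 + S.strain t) * (1 + S.θ t x) ^ (n + 1) := by
      refine tInt_mono (by fun_prop) (by fun_prop) fun x => ?_
      have := mul_le_mul_of_nonneg_left
        (S.stress_mul_px_u_le H hc (hvb S hS t ht x).1) (pow_nonneg (hψ0 t x) n)
      refine this.trans (le_of_eq ?_)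
      ring
    rw [tInt_const_mul] at k3
    rw [e1]
    have k4 : (n + 1) / cv * (tInt (fun x => (1 + S.θ t x) ^ n * px S.flux t x)
          - tInt (fun x => px S.q t x * (1 + S.θ t x) ^ n)
          + tInt fun x => (1 + S.θ t x) ^ n * (S.stress t x * px S.u t x))
        ≤ (n + 1) / cv * (cv * K * (1 + S.strain t) * tInt fun x => (1 + S.θ t x) ^ (n + 1)) := by
      rw [hKe]
      refine mul_le_mul_of_nonneg_left (by linarith) (by positivity)
    have k5 : (n + 1) / cv * (cv * K * (1 + S.strain t) * tInt fun x => (1 + S.θ t x) ^ (n + 1))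
        = (n + 1) * K * (1 + S.strain t) * tInt fun x => (1 + S.θ t x) ^ (n + 1) := by
      field_simp
    linarith
  · obtain ⟨-, -, d1, d2⟩ := hS.data
    rw [← tInt_const ((1 + 2 * M) ^ (n + 1))]
    refine tInt_mono ((hψ.pow (n + 1)).continuous_slice 0) continuous_const fun x => ?_
    have := S.hθ.le_two_mul (by linarith [H.one_le_M]) d1 d2 x
    exact pow_le_pow_left₀ (hψ0 0 x) (by linarith) _

end Sol

/-- The pointwise estimate of the time derivative of the squared heat flux. -/
lemma flux_rate_le {k₀ k₁ k cv κ c v F φ f z p m : ℝ} (hk₀ : 0 < k₀) (hk : k₀ ≤ k) (hk₁ : k ≤ k₁)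
    (hcv : 0 < cv) (hκ : 0 < κ) (hc : 0 < c) (hv : c ≤ v) (hp : p ^ 2 ≤ m) :
    -2 * (φ * (k * ((φ + f) / cv))) + 2 * (F * (κ * (z * ((φ + f) / cv) - p * (F / k)) / v ^ 2))
      ≤ (-(k₀ / (2 * cv)) * φ ^ 2 + (k₁ / cv + k₀ / (2 * cv)) * f ^ 2)
        + (4 * κ ^ 2 / (k₀ * cv * c ^ 4) * (F ^ 2 * z ^ 2)
          + 2 * κ / (k₀ * c ^ 2) * (1 + m) * F ^ 2) := by
  have hk0 : 0 < k := hk₀.trans_le hk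
  have hv0 : 0 < v := hc.trans_le hv
  have e1 : -2 * (φ * (k * ((φ + f) / cv))) ≤ -(k / cv) * φ ^ 2 + k / cv * f ^ 2 := by
    have e : -(k / cv) * φ ^ 2 + k / cv * f ^ 2 - -2 * (φ * (k * ((φ + f) / cv)))
        = k / cv * (φ + f) ^ 2 := by field_simp; ring
    have : 0 ≤ k / cv * (φ + f) ^ 2 := by positivity
    linarith
  have e2 : k₀ / cv * φ ^ 2 ≤ k / cv * φ ^ 2 := by gcongr
  have e3 : k / cv * f ^ 2 ≤ k₁ / cv * f ^ 2 := by gcongr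
  have e4 : 2 * (F * (κ * (z * ((φ + f) / cv)) / v ^ 2))
      ≤ 4 * κ ^ 2 / (k₀ * cv * v ^ 4) * (F ^ 2 * z ^ 2) + k₀ / (4 * cv) * (φ + f) ^ 2 := by
    have e : 4 * κ ^ 2 / (k₀ * cv * v ^ 4) * (F ^ 2 * z ^ 2) + k₀ / (4 * cv) * (φ + f) ^ 2
        - 2 * (F * (κ * (z * ((φ + f) / cv)) / v ^ 2))
        = (4 * κ * (F * z) - k₀ * v ^ 2 * (φ + f)) ^ 2 / (4 * k₀ * cv * v ^ 4) := by
      field_simp; ring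
    have : 0 ≤ (4 * κ * (F * z) - k₀ * v ^ 2 * (φ + f)) ^ 2 / (4 * k₀ * cv * v ^ 4) := by
      positivity
    linarith
  have e5 : 4 * κ ^ 2 / (k₀ * cv * v ^ 4) * (F ^ 2 * z ^ 2)
      ≤ 4 * κ ^ 2 / (k₀ * cv * c ^ 4) * (F ^ 2 * z ^ 2) := by gcongr
  have e6 : k₀ / (4 * cv) * (φ + f) ^ 2 ≤ k₀ / (2 * cv) * φ ^ 2 + k₀ / (2 * cv) * f ^ 2 := by
    have e : k₀ / (2 * cv) * φ ^ 2 + k₀ / (2 * cv) * f ^ 2 - k₀ / (4 * cv) * (φ + f) ^ 2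
        = k₀ / (4 * cv) * (φ - f) ^ 2 := by field_simp; ring
    have : 0 ≤ k₀ / (4 * cv) * (φ - f) ^ 2 := by positivity
    linarith
  have e7 : 2 * (F * (κ * -(p * (F / k)) / v ^ 2)) ≤ 2 * κ / (k₀ * c ^ 2) * (1 + m) * F ^ 2 := by
    have hm : 0 ≤ 1 + m := by nlinarith [sq_nonneg p]
    have hpm : -p ≤ 1 + m := by nlinarith [sq_nonneg (p + 1)]
    have e : 2 * (F * (κ * -(p * (F / k)) / v ^ 2)) = 2 * κ / (k * v ^ 2) * F ^ 2 * -p := by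
      field_simp
    rw [e]
    calc 2 * κ / (k * v ^ 2) * F ^ 2 * -p ≤ 2 * κ / (k * v ^ 2) * F ^ 2 * (1 + m) := by gcongr
      _ ≤ 2 * κ / (k₀ * c ^ 2) * F ^ 2 * (1 + m) := by gcongr
      _ = _ := by ring
  have e8 : 2 * (F * (κ * (z * ((φ + f) / cv) - p * (F / k)) / v ^ 2))
      = 2 * (F * (κ * (z * ((φ + f) / cv)) / v ^ 2)) + 2 * (F * (κ * -(p * (F / k)) / v ^ 2)) := by
    ring
  have e9 : k₀ / cv = 2 * (k₀ / (2 * cv)) := by field_simp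
  rw [e9] at e2
  rw [e8]
  linarith

namespace Sol

variable {μ R a b κ₁ κ₂ β γ T M ε : ℝ}

/-! ### Bound on the heat flux -/

/-- The heat source `σ u_x - q_x`. -/
def source (S : Sol μ R a b κ₁ κ₂ β γ T) (t x : ℝ) : ℝ :=
  S.stress t x * px S.u t x - px S.q t x

lemma hsource (S : Sol μ R a b κ₁ κ₂ β γ T) : SmoothPeriodic S.source :=
  (S.hstress.mul S.hu.px).sub S.hq.px

lemma pt_θ (H : Admissible μ R a b κ₁ κ₂ β γ T M ε) (S : Sol μ R a b κ₁ κ₂ β γ T)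
    {t : ℝ} (ht : t ∈ Icc 0 T) (x : ℝ) :
    pt S.θ t x = (px S.flux t x + S.source t x) / (R / (γ - 1)) := by
  have h := energy_eq (S := S) ht x
  have hcv := H.cv_pos
  rw [eq_div_iff hcv.ne', source]
  linarith

lemma px_θ_eq (H : Admissible μ R a b κ₁ κ₂ β γ T M ε) (S : Sol μ R a b κ₁ κ₂ β γ T)
    (t x : ℝ) : px S.θ t x = S.flux t x / S.cond t x := by
  have := (S.cond_pos H t x).ne'
  rw [flux]; field_simp

lemma px_cond (S : Sol μ R a b κ₁ κ₂ β γ T) (t x : ℝ) :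
    px S.cond t x = -(κ₁ * px S.v t x / S.v t x ^ 2)
      + κ₂ * (β * S.θ t x ^ (β - 1)) * px S.θ t x := by
  have h := (((hasDerivAt_const x κ₁).div (S.hv.hasDerivAt_px t x) (S.v_pos t x).ne').add
    (((S.hθ.hasDerivAt_px t x).rpow_const (p := β)
      (Or.inl (S.θ_pos t x).ne')).const_mul κ₂)).deriv
  refine h.trans ?_
  ring

lemma pt_cond (S : Sol μ R a b κ₁ κ₂ β γ T) (t x : ℝ) :
    pt S.cond t x = -(κ₁ * pt S.v t x / S.v t x ^ 2)
      + κ₂ * (β * S.θ t x ^ (β - 1)) * pt S.θ t x := by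
  have h := (((hasDerivAt_const t κ₁).div (S.hv.hasDerivAt_pt t x) (S.v_pos t x).ne').add
    (((S.hθ.hasDerivAt_pt t x).rpow_const (p := β)
      (Or.inl (S.θ_pos t x).ne')).const_mul κ₂)).deriv
  refine h.trans ?_
  ring

lemma pt_flux {S : Sol μ R a b κ₁ κ₂ β γ T} {t : ℝ} (ht : t ∈ Icc 0 T) (x : ℝ) :
    pt S.flux t x = px (fun t x => S.cond t x * pt S.θ t x) t x
      + κ₁ * (px S.v t x * pt S.θ t x - px S.u t x * px S.θ t x) / S.v t x ^ 2 := by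
  have h1 : pt S.flux t x = _ :=
    ((S.hcond.hasDerivAt_pt t x).mul (S.hθ.px.hasDerivAt_pt t x)).deriv
  have h2 : px (fun t x => S.cond t x * pt S.θ t x) t x = _ :=
    ((S.hcond.hasDerivAt_px t x).mul (S.hθ.pt.hasDerivAt_px t x)).deriv
  rw [h1, h2, pt_cond, px_cond, pt_v ht, S.hθ.pt_px]
  ring

lemma exists_cond_bound (H : Admissible μ R a b κ₁ κ₂ β γ T M ε) :
    ∃ k₀ k₁, 0 < k₀ ∧ 0 < k₁ ∧ ∀ S : Sol μ R a b κ₁ κ₂ β γ T, S.Bounded M ε → ∀ t ∈ Icc 0 T, ∀ x,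
      k₀ ≤ S.cond t x ∧ S.cond t x ≤ k₁ := by
  obtain ⟨c, V, hc, hV, hvb⟩ := exists_v_bound H
  obtain ⟨Θ, hΘ, hθ⟩ := exists_θ_bound H
  have h1 := H.κ₁_pos
  have h2 := H.κ₂_pos
  have hβ : 0 ≤ β := by linarith [H.two_le_β]
  refine ⟨κ₁ / V, κ₁ / c + κ₂ * Θ ^ β, by positivity, by positivity, fun S hS t ht x => ?_⟩
  obtain ⟨i1, i2⟩ := hvb S hS t ht x
  have i3 := hθ S hS t ht x
  have i4 := S.θ_pos t x
  have i5 := S.v_pos t x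
  constructor
  · have : κ₁ / V ≤ κ₁ / S.v t x := by gcongr
    have : 0 ≤ κ₂ * S.θ t x ^ β := by positivity
    rw [cond]; linarith
  · rw [cond]; gcongr

lemma tInt_px_q_sq_le (H : Admissible μ R a b κ₁ κ₂ β γ T M ε) (S : Sol μ R a b κ₁ κ₂ β γ T)
    {t V Θ : ℝ} (ht : t ∈ Icc 0 T) (hV : ∀ x, S.v t x ≤ V) (hΘ : ∀ x, S.θ t x ≤ Θ) :
    tInt (fun x => px S.q t x ^ 2) ≤ V * (V * (b * Θ ^ 4) ^ 2) := by
  have hb := H.b_pos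
  have hV0 : 0 < V := (S.v_pos t 0).trans_le (hV 0)
  have cq := S.hq.px.continuous_slice t
  have cv := S.hv.continuous_slice t
  have cw := S.hrad.continuous_slice t
  have cq' := S.hq.continuous_slice t
  have h1 : 0 ≤ tInt fun x => S.rad t x * px S.q t x := by
    rw [S.hrad.tInt_mul_px S.hq, ← neg_one_mul, ← tInt_const_mul]
    refine tInt_nonneg fun x => ?_
    rw [px_rad ht]
    have := mul_nonneg (mul_pos H.a_pos (S.v_pos t x)).le (sq_nonneg (S.q t x))
    linarith
  have h2 : tInt (fun x => px S.q t x ^ 2)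
      ≤ tInt fun x => V * (V * (b * Θ ^ 4) ^ 2) + -(2 * V) * (S.rad t x * px S.q t x) := by
    refine tInt_mono (by fun_prop) (by fun_prop) fun x => ?_
    have hv := S.v_pos t x
    have hθ := S.θ_pos t x
    have i1 : S.v t x * (b * S.θ t x ^ 4) ^ 2 ≤ V * (b * Θ ^ 4) ^ 2 := by
      have := hV x
      have := hΘ x
      gcongr
    rw [px_q]
    set B := b * S.θ t x ^ 4
    set w := S.rad t x
    set v := S.v t x
    have i2 : v * (B - w) ^ 2 ≤ V * (b * Θ ^ 4) ^ 2 - 2 * (w * (v * (B - w))) := by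
      nlinarith [mul_nonneg hv.le (sq_nonneg w)]
    have i3 := mul_le_mul_of_nonneg_left i2 hV0.le
    have i4 : (v * (B - w)) ^ 2 ≤ V * (v * (B - w) ^ 2) := by
      have := mul_le_mul_of_nonneg_right (hV x) (mul_nonneg hv.le (sq_nonneg (B - w)))
      linarith
    linarith
  rw [tInt_add (by fun_prop) (by fun_prop), tInt_const, tInt_const_mul] at h2
  have := mul_nonneg hV0.le h1
  linarith

lemma exists_source_bound (H : Admissible μ R a b κ₁ κ₂ β γ T M ε) :
    ∃ C, 0 < C ∧ ∀ S : Sol μ R a b κ₁ κ₂ β γ T, S.Bounded M ε → ∀ t ∈ Icc 0 T,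
      tInt (fun x => S.source t x ^ 2) ≤ C * (1 + S.strain t) := by
  obtain ⟨c, V, hc, hV, hvb⟩ := exists_v_bound H
  obtain ⟨Θ, hΘ, hθ⟩ := exists_θ_bound H
  obtain ⟨P, hP, hux⟩ := exists_px_u_bound H
  have hμ := H.μ_pos
  have hR := H.R_pos
  have hb := H.b_pos
  set Q := V * (V * (b * Θ ^ 4) ^ 2) with hQ
  set A := 4 * (μ ^ 2 / c ^ 2) with hA
  set B := 4 * (R ^ 2 * Θ ^ 2 / c ^ 2) with hB
  refine ⟨(A + B) * P + 2 * Q, by positivity, fun S hS t ht => ?_⟩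
  have hm := S.strain_nonneg t
  have hq := S.tInt_px_q_sq_le H ht (fun x => (hvb S hS t ht x).2) (hθ S hS t ht)
  have cq := S.hq.px.continuous_slice t
  have cf := S.hsource.continuous_slice t
  have cp := S.hu.px.continuous_slice t
  have key : tInt (fun x => S.source t x ^ 2)
      ≤ tInt fun x => (A * S.strain t + B) * px S.u t x ^ 2 + 2 * px S.q t x ^ 2 := by
    refine tInt_mono (by fun_prop) (by fun_prop) fun x => ?_
    have hv := S.v_pos t x
    have hθ0 := S.θ_pos t x
    have i1 : S.source t x ^ 2
        ≤ 2 * (S.stress t x * px S.u t x) ^ 2 + 2 * px S.q t x ^ 2 := by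
      rw [source]
      nlinarith [sq_nonneg (S.stress t x * px S.u t x + px S.q t x)]
    have i2 : S.stress t x ^ 2 ≤ 2 * (μ ^ 2 * px S.u t x ^ 2 / S.v t x ^ 2
        + R ^ 2 * S.θ t x ^ 2 / S.v t x ^ 2) := by
      have e1 : μ ^ 2 * px S.u t x ^ 2 / S.v t x ^ 2 = (μ * px S.u t x / S.v t x) ^ 2 := by ring
      have e2 : R ^ 2 * S.θ t x ^ 2 / S.v t x ^ 2 = (R * S.θ t x / S.v t x) ^ 2 := by ring
      rw [e1, e2, stress, pressure]
      nlinarith [sq_nonneg (μ * px S.u t x / S.v t x + R * S.θ t x / S.v t x)]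
    have i3 : μ ^ 2 * px S.u t x ^ 2 / S.v t x ^ 2 + R ^ 2 * S.θ t x ^ 2 / S.v t x ^ 2
        ≤ μ ^ 2 * S.strain t / c ^ 2 + R ^ 2 * Θ ^ 2 / c ^ 2 := by
      have := (hvb S hS t ht x).1
      have := hθ S hS t ht x
      have := S.px_u_sq_le_strain t x
      gcongr
    have i4 : 2 * (2 * (μ ^ 2 * S.strain t / c ^ 2 + R ^ 2 * Θ ^ 2 / c ^ 2))
        = A * S.strain t + B := by rw [hA, hB]; ring
    have i5 := mul_le_mul_of_nonneg_right
      (show 2 * S.stress t x ^ 2 ≤ A * S.strain t + B by linarith) (sq_nonneg (px S.u t x))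
    rw [mul_pow] at i1
    linarith
  rw [tInt_add (by fun_prop) (by fun_prop), tInt_const_mul, tInt_const_mul] at key
  have k1 := mul_le_mul_of_nonneg_left (hux S hS t ht).1
    (by positivity : 0 ≤ A * S.strain t + B)
  have k2 : 0 ≤ A * P + B * P * S.strain t + 2 * Q * S.strain t := by positivity
  linarith

lemma exists_flux_bound (H : Admissible μ R a b κ₁ κ₂ β γ T M ε) :
    ∃ C, 0 < C ∧ ∀ S : Sol μ R a b κ₁ κ₂ β γ T, S.Bounded M ε → ∀ t ∈ Icc 0 T,
      tInt (fun x => S.flux t x ^ 2) ≤ C ∧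
        ∫ s in (0 : ℝ)..t, tInt (fun x => px S.flux s x ^ 2) ≤ C := by
  obtain ⟨c, V, hc, hV, hvb⟩ := exists_v_bound H
  obtain ⟨k₀, k₁, hk₀, hk₁, hk⟩ := exists_cond_bound H
  obtain ⟨m, hm, hstr⟩ := exists_strain_bound H
  obtain ⟨W, hW, hvx⟩ := exists_px_v_bound H
  obtain ⟨Φ, hΦ, hsrc⟩ := exists_source_bound H
  have hκ := H.κ₁_pos
  have hT := H.T_pos
  have hcv := H.cv_pos
  set cv := R / (γ - 1) with hcvd
  set A₁ := 4 * κ₁ ^ 2 / (k₀ * cv * c ^ 4) with hA₁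
  have hA₁0 : 0 < A₁ := by positivity
  set A₂ := 2 * κ₁ / (k₀ * c ^ 2) with hA₂
  have hA₂0 : 0 < A₂ := by positivity
  set A₃ := k₁ / cv + k₀ / (2 * cv) with hA₃
  have hA₃0 : 0 < A₃ := by positivity
  set η := k₀ / (4 * cv) / (A₁ * W) with hη
  have hη0 : 0 < η := by positivity
  have hηe : A₁ * W * η = k₀ / (4 * cv) := by rw [hη]; field_simp
  set A := A₁ * W * (1 + 1 / η) + A₂ with hA
  have hA0 : 0 < A := by positivity
  set B := exp (A * (T + m)) * (k₁ ^ 2 * M ^ 2 + A₃ * Φ * (T + m)) with hB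
  have hB0 : 0 < B := by
    have := H.one_le_M
    positivity
  refine ⟨B + 4 * cv / k₀ * B, by positivity, fun S hS t ht => ?_⟩
  have hdφ := (S.hflux.px.pow 2).continuous_tInt
  have cs := S.continuous_strain
  have h := gronwall_dissipation (T := T) (A := A * (T + m)) (G := A₃ * Φ * (T + m))
      (Y := k₁ ^ 2 * M ^ 2) (y := fun t => tInt fun x => S.flux t x ^ 2)
      (α := fun t => A * (1 + S.strain t)) (g := fun t => A₃ * Φ * (1 + S.strain t))
      (d := fun t => k₀ / (4 * cv) * tInt fun x => px S.flux t x ^ 2) hT.le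
      (by fun_prop) (by fun_prop) (hdφ.const_mul _)
      (fun t => by have := S.strain_nonneg t; positivity)
      (fun t => by have := S.strain_nonneg t; positivity)
      (fun t => mul_nonneg (by positivity) (tInt_nonneg fun x => sq_nonneg _))
      (fun t => tInt_nonneg fun x => sq_nonneg _) S.hflux.hasDerivAt_tInt_sq
      (fun t ht => ?_) (integral_const_mul_one_add_le cs hA0.le (hstr S hS))
      (integral_const_mul_one_add_le cs (by positivity) (hstr S hS)) ?_ t ht
  · rw [intervalIntegral.integral_const_mul] at h
    have n1 : 0 ≤ tInt (fun x => S.flux t x ^ 2) := tInt_nonneg fun x => sq_nonneg _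
    have n2 : 0 ≤ ∫ s in (0 : ℝ)..t, tInt (fun x => px S.flux s x ^ 2) :=
      intervalIntegral.integral_nonneg ht.1 fun s _ => tInt_nonneg fun x => sq_nonneg _
    have n3 : 0 ≤ 4 * cv / k₀ * B := by positivity
    have n4 : 0 ≤ k₀ / (4 * cv) := by positivity
    have n5 := mul_nonneg n4 n2
    refine ⟨by linarith, ?_⟩
    have h' : k₀ / (4 * cv) * (∫ s in (0 : ℝ)..t, tInt (fun x => px S.flux s x ^ 2)) ≤ B := by
      linarith
    have := mul_le_mul_of_nonneg_left h' (by positivity : 0 ≤ 4 * cv / k₀)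
    have e : ∀ z, 4 * cv / k₀ * (k₀ / (4 * cv) * z) = z := fun z => by field_simp
    rw [e] at this
    linarith
  · have hmn := S.strain_nonneg t
    have cF := S.hflux.continuous_slice t
    have cφ := S.hflux.px.continuous_slice t
    have cf := S.hsource.continuous_slice t
    have cz := S.hv.px.continuous_slice t
    have cv' := S.hv.continuous_slice t
    have cp := S.hu.px.continuous_slice t
    have cθt := S.hθ.pt.continuous_slice t
    have cθx := S.hθ.px.continuous_slice t
    have hkt := S.hcond.mul S.hθ.pt
    have ck := S.hcond.continuous_slice t
    have cr := hkt.px.continuous_slice t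
    have cg : Continuous fun x =>
        κ₁ * (px S.v t x * pt S.θ t x - px S.u t x * px S.θ t x) / S.v t x ^ 2 :=
      Continuous.div (by fun_prop) (by fun_prop) fun x => (pow_pos (S.v_pos t x) 2).ne'
    have cFr : Continuous fun x => S.flux t x * px (fun t x => S.cond t x * pt S.θ t x) t x :=
      cF.mul cr
    have cFg : Continuous fun x => S.flux t x * (κ₁ * (px S.v t x * pt S.θ t x
        - px S.u t x * px S.θ t x) / S.v t x ^ 2) := cF.mul cg
    have e1 : tInt (fun x => 2 * (S.flux t x * pt S.flux t x))
        = tInt fun x => -2 * (px S.flux t x * (S.cond t x * pt S.θ t x))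
          + 2 * (S.flux t x * (κ₁ * (px S.v t x * pt S.θ t x - px S.u t x * px S.θ t x)
            / S.v t x ^ 2)) := by
      have : (fun x => S.flux t x * pt S.flux t x) = fun x =>
          S.flux t x * px (fun t x => S.cond t x * pt S.θ t x) t x
          + S.flux t x * (κ₁ * (px S.v t x * pt S.θ t x - px S.u t x * px S.θ t x)
            / S.v t x ^ 2) := by
        funext x; rw [pt_flux ht, mul_add]
      rw [tInt_const_mul, this, tInt_add cFr cFg, S.hflux.tInt_mul_px hkt,
        tInt_add (by fun_prop) (cFg.const_mul 2), tInt_const_mul, tInt_const_mul]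
      ring
    set N := (1 + 1 / η) * tInt (fun y => S.flux t y ^ 2)
      + η * tInt fun y => px S.flux t y ^ 2 with hN
    have hsup : ∀ x, S.flux t x ^ 2 ≤ N := fun x =>
      sq_le_tInt_sq (S.hflux.periodic t) (S.hflux.hasDerivAt_px t) cφ hη0 x
    have hN0 : 0 ≤ N := (sq_nonneg _).trans (hsup 0)
    have key : tInt (fun x => -2 * (px S.flux t x * (S.cond t x * pt S.θ t x))
          + 2 * (S.flux t x * (κ₁ * (px S.v t x * pt S.θ t x - px S.u t x * px S.θ t x)
            / S.v t x ^ 2)))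
        ≤ tInt fun x => (-(k₀ / (2 * cv)) * px S.flux t x ^ 2 + A₃ * S.source t x ^ 2)
          + (A₁ * N * px S.v t x ^ 2 + A₂ * (1 + S.strain t) * S.flux t x ^ 2) := by
      refine tInt_mono ((Continuous.const_mul (by fun_prop) _).add (cFg.const_mul 2))
        (by fun_prop) fun x => ?_
      rw [S.pt_θ H ht, S.px_θ_eq H, ← hcvd]
      have i1 := flux_rate_le (F := S.flux t x) (φ := px S.flux t x) (f := S.source t x)
        (z := px S.v t x) hk₀ (hk S hS t ht x).1 (hk S hS t ht x).2 hcv hκ hc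
        (hvb S hS t ht x).1 (S.px_u_sq_le_strain t x)
      rw [← hA₁, ← hA₂, ← hA₃] at i1
      have i2 := mul_le_mul_of_nonneg_left
        (mul_le_mul_of_nonneg_right (hsup x) (sq_nonneg (px S.v t x))) hA₁0.le
      linarith
    rw [← e1, tInt_add (by fun_prop) (by fun_prop), tInt_add (by fun_prop) (by fun_prop),
      tInt_add (by fun_prop) (by fun_prop),
      tInt_const_mul (-(k₀ / (2 * cv))), tInt_const_mul A₃, tInt_const_mul (A₁ * N),
      tInt_const_mul (A₂ * _)] at key
    have k1 := mul_le_mul_of_nonneg_left (hsrc S hS t ht) hA₃0.le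
    have k2 := mul_le_mul_of_nonneg_left (hvx S hS t ht) (by positivity : 0 ≤ A₁ * N)
    have k3 : A₁ * N * W = A₁ * W * (1 + 1 / η) * tInt (fun y => S.flux t y ^ 2)
        + k₀ / (4 * cv) * tInt fun y => px S.flux t y ^ 2 := by
      rw [← hηe, hN]; ring
    have k4 : k₀ / (2 * cv) = 2 * (k₀ / (4 * cv)) := by field_simp; norm_num
    have n1 : 0 ≤ tInt (fun x => S.flux t x ^ 2) := tInt_nonneg fun x => sq_nonneg _
    have k5 : 0 ≤ A₁ * W * (1 + 1 / η) * S.strain t * tInt (fun x => S.flux t x ^ 2) := by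
      positivity
    rw [k4] at key
    rw [hA]
    linarith
  · rw [← mul_comm (M ^ 2), mul_comm]
    refine le_trans ?_ (mul_le_mul_of_nonneg_left hS.data.2.2.2 (sq_nonneg k₁))
    rw [← tInt_const_mul]
    have cF := S.hflux.continuous_slice 0
    have cθ := S.hθ.px.continuous_slice 0
    refine tInt_mono (by fun_prop) (by fun_prop) fun x => ?_
    rw [flux, mul_pow]
    have := S.cond_pos H 0 x
    have := (hk S hS 0 (left_mem_Icc.2 hT.le) x).2
    gcongr

/-! ### Bound on the second derivative of the temperature -/

lemma cond_mul_px_px_θ (S : Sol μ R a b κ₁ κ₂ β γ T) (t x : ℝ) :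
    S.cond t x * px (px S.θ) t x = px S.flux t x + κ₁ * px S.v t x / S.v t x ^ 2 * px S.θ t x
      + -(κ₂ * (β * S.θ t x ^ (β - 1)) * px S.θ t x ^ 2) := by
  have h : px S.flux t x = _ :=
    ((S.hcond.hasDerivAt_px t x).mul (S.hθ.px.hasDerivAt_px t x)).deriv
  rw [h, px_cond]
  ring

lemma exists_px_px_θ_bound (H : Admissible μ R a b κ₁ κ₂ β γ T M ε) :
    ∃ C, 0 < C ∧ ∀ S : Sol μ R a b κ₁ κ₂ β γ T, S.Bounded M ε → ∀ t ∈ Icc 0 T,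
      ∫ s in (0 : ℝ)..t, tInt (fun x => px (px S.θ) s x ^ 2) ≤ C := by
  obtain ⟨c, V, hc, hV, hvb⟩ := exists_v_bound H
  obtain ⟨k₀, k₁, hk₀, hk₁, hk⟩ := exists_cond_bound H
  obtain ⟨W, hW, hvx⟩ := exists_px_v_bound H
  obtain ⟨Θ, hΘ, hθ⟩ := exists_θ_bound H
  obtain ⟨Y, hY, hF⟩ := exists_flux_bound H
  have h1 := H.κ₁_pos
  have h2 := H.κ₂_pos
  have hβ := H.two_le_β
  have hT := H.T_pos
  set α₁ := κ₁ / (c ^ 2 * k₀) with hα₁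
  set α₂ := κ₂ * (β * Θ ^ (β - 1)) / k₀ ^ 2 with hα₂
  have hα₁0 : 0 < α₁ := by positivity
  have hα₂0 : 0 < α₂ := by positivity
  set D := 3 / k₀ ^ 2 * (1 + α₁ ^ 2 + α₂ ^ 2) with hD
  have hD0 : 0 < D := by positivity
  refine ⟨D * ((1 + W + Y) * Y + T * (2 * Y * (W + Y))), by positivity, fun S hS t ht => ?_⟩
  have main : ∀ s ∈ Icc 0 t, tInt (fun x => px (px S.θ) s x ^ 2)
      ≤ D * ((1 + W + Y) * tInt (fun x => px S.flux s x ^ 2) + 2 * Y * (W + Y)) := by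
    intro s hs
    have hs' : s ∈ Icc 0 T := ⟨hs.1, hs.2.trans ht.2⟩
    have cφ := S.hflux.px.continuous_slice s
    have cF := S.hflux.continuous_slice s
    have cz := S.hv.px.continuous_slice s
    have cθ := S.hθ.px.px.continuous_slice s
    set N := (1 + 1 / 1) * tInt (fun y => S.flux s y ^ 2)
      + 1 * tInt fun y => px S.flux s y ^ 2 with hN
    have hsup : ∀ x, S.flux s x ^ 2 ≤ N := fun x =>
      sq_le_tInt_sq (S.hflux.periodic s) (S.hflux.hasDerivAt_px s) cφ one_pos x
    have hN0 : 0 ≤ N := (sq_nonneg _).trans (hsup 0)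
    have key : tInt (fun x => px (px S.θ) s x ^ 2)
        ≤ tInt fun x => D * (px S.flux s x ^ 2 + N * (px S.v s x ^ 2 + S.flux s x ^ 2)) := by
      refine tInt_mono (by fun_prop) (by fun_prop) fun x => ?_
      have hv := S.v_pos s x
      have hθ0 := S.θ_pos s x
      have hcv := (hvb S hS s hs' x).1
      have hkx := (hk S hS s hs' x).1
      have hk0 := S.cond_pos H s x
      have hθx := hθ S hS s hs' x
      have hsx := hsup x
      have e := S.cond_mul_px_px_θ s x
      set z := px S.v s x
      set F := S.flux s x
      set p := κ₁ * z / S.v s x ^ 2 * px S.θ s x with hp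
      set r := κ₂ * (β * S.θ s x ^ (β - 1)) * px S.θ s x ^ 2 with hr
      have ip : p ^ 2 ≤ α₁ ^ 2 * (F ^ 2 * z ^ 2) := by
        have e' : p ^ 2 = (κ₁ / (S.v s x ^ 2 * S.cond s x)) ^ 2 * (F ^ 2 * z ^ 2) := by
          rw [hp, S.px_θ_eq H]; ring
        rw [e', hα₁]
        gcongr
      have ir : r ^ 2 ≤ α₂ ^ 2 * (F ^ 2 * F ^ 2) := by
        have e' : r ^ 2 = (κ₂ * (β * S.θ s x ^ (β - 1)) / S.cond s x ^ 2) ^ 2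
            * (F ^ 2 * F ^ 2) := by
          rw [hr, S.px_θ_eq H]; ring
        have : S.θ s x ^ (β - 1) ≤ Θ ^ (β - 1) :=
          rpow_le_rpow hθ0.le hθx (by linarith)
        rw [e', hα₂]
        gcongr
      have i1 : (px S.flux s x + p + -r) ^ 2 ≤ 3 * (px S.flux s x ^ 2 + p ^ 2 + r ^ 2) := by
        nlinarith [sq_nonneg (px S.flux s x - p), sq_nonneg (px S.flux s x + r),
          sq_nonneg (p + r)]
      have j1 := mul_le_mul_of_nonneg_right hsx (sq_nonneg z)
      have j2 := mul_le_mul_of_nonneg_right hsx (sq_nonneg F)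
      have i2 : px S.flux s x ^ 2 + p ^ 2 + r ^ 2 ≤ (1 + α₁ ^ 2 + α₂ ^ 2)
          * (px S.flux s x ^ 2 + N * (z ^ 2 + F ^ 2)) := by
        have := mul_le_mul_of_nonneg_left j1 (sq_nonneg α₁)
        have := mul_le_mul_of_nonneg_left j2 (sq_nonneg α₂)
        have : 0 ≤ (α₁ ^ 2 + α₂ ^ 2) * px S.flux s x ^ 2 + N * (z ^ 2 + F ^ 2)
          + α₁ ^ 2 * (N * F ^ 2) + α₂ ^ 2 * (N * z ^ 2) := by positivity
        linarith
      have i3 : k₀ ^ 2 * px (px S.θ) s x ^ 2 ≤ (S.cond s x * px (px S.θ) s x) ^ 2 := by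
        rw [mul_pow]; gcongr
      rw [e] at i3
      have i4 : px (px S.θ) s x ^ 2 = k₀ ^ 2 * px (px S.θ) s x ^ 2 / k₀ ^ 2 := by field_simp
      have i5 : D * (px S.flux s x ^ 2 + N * (z ^ 2 + F ^ 2)) = 3 * ((1 + α₁ ^ 2 + α₂ ^ 2)
          * (px S.flux s x ^ 2 + N * (z ^ 2 + F ^ 2))) / k₀ ^ 2 := by rw [hD]; ring
      rw [i4, i5]
      exact div_le_div_of_nonneg_right (by linarith) (sq_nonneg k₀)
    rw [tInt_const_mul, tInt_add (by fun_prop) (by fun_prop), tInt_const_mul,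
      tInt_add (by fun_prop) (by fun_prop)] at key
    refine key.trans (mul_le_mul_of_nonneg_left ?_ hD0.le)
    have hFs := (hF S hS s hs').1
    have k1 := mul_le_mul_of_nonneg_left (add_le_add (hvx S hS s hs') hFs) hN0
    have k2 : N ≤ 2 * Y + tInt fun y => px S.flux s y ^ 2 := by rw [hN]; linarith
    have k3 := mul_le_mul_of_nonneg_right k2 (by positivity : 0 ≤ W + Y)
    linarith
  have cφ := (S.hflux.px.pow 2).continuous_tInt
  have cθ := (S.hθ.px.px.pow 2).continuous_tInt
  have cr : Continuous fun s =>
      D * ((1 + W + Y) * tInt (fun x => px S.flux s x ^ 2) + 2 * Y * (W + Y)) := by fun_prop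
  have hm := intervalIntegral.integral_mono_on (μ := volume) ht.1 (cθ.intervalIntegrable 0 t)
    (cr.intervalIntegrable 0 t) main
  refine hm.trans ?_
  rw [intervalIntegral.integral_const_mul, intervalIntegral.integral_add
    ((cφ.const_mul _).intervalIntegrable 0 t) (continuous_const.intervalIntegrable 0 t),
    intervalIntegral.integral_const_mul, intervalIntegral.integral_const, smul_eq_mul, sub_zero]
  have := (hF S hS t ht).2
  have := ht.2
  gcongr

end Sol

end RadHydro

theorem stmt_16 (μ R a b κ₁ κ₂ β γ : ℝ)
    (hμ : 0 < μ) (hR : 0 < R) (ha : 0 < a) (hb : 0 < b)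
    (hκ₁ : 0 < κ₁) (hκ₂ : 0 < κ₂) (hβ : 157 / 17 < β) (hγ : 1 < γ)
    (T M ε : ℝ) (hT : 0 < T) (hM : 1 ≤ M) (hε0 : 0 < ε) (hε1 : ε ≤ 1) :
    ∃ C : ℝ, 0 < C ∧
      ∀ S : Sol μ R a b κ₁ κ₂ β γ T, S.Bounded M ε →
        ∀ t ∈ Icc (0 : ℝ) T,
          (∫ s in (0 : ℝ)..t, L2sq (px (px S.θ) s)) ≤ C := by
  exact Sol.exists_px_px_θ_bound ⟨hμ, hR, ha, hb, hκ₁, hκ₂, by linarith, hγ, hT, hM, hε0, hε1⟩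
end
end

section
/- Let a > 0 and b > 0, and let θ, q : ℝ → ℝ be C^∞ functions, each 1-periodic, satisfying the elliptic equation −q''(y) + a q(y) + b (θ⁴)'(y) = 0 for all y ∈ ℝ. Then q'(y) ≤ b θ(y)⁴ for every y ∈ ℝ. -/
open MeasureTheory Real Set

noncomputable section

open RadHydro

/-- A continuous periodic function attains its maximum. -/
theorem Function.Periodic.exists_forall_le_of_continuous {f : ℝ → ℝ} {c : ℝ}
    (hp : Function.Periodic f c) (hc : 0 < c) (hf : Continuous f) : ∃ x₀, ∀ x, f x ≤ f x₀ := by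
  obtain ⟨x₀, -, hx₀⟩ :=
    isCompact_Icc.exists_isMaxOn (nonempty_Icc.2 hc.le) hf.continuousOn
  refine ⟨x₀, fun x => ?_⟩
  obtain ⟨y, hy, hxy⟩ := hp.exists_mem_Ico₀ hc x
  exact hxy ▸ hx₀ (Ico_subset_Icc_self hy)

/-- The derivative of a periodic function is periodic. -/
theorem Function.Periodic.periodic_deriv {f : ℝ → ℝ} {c : ℝ} (hp : Function.Periodic f c) :
    Function.Periodic (deriv f) c := fun x => by
  rw [← deriv_comp_add_const, funext hp]

/-- Second derivative test, necessary condition at a local maximum. -/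
theorem IsLocalMax.deriv_deriv_nonpos {f : ℝ → ℝ} {x₀ : ℝ} (h : IsLocalMax f x₀)
    (hf : ContinuousAt f x₀) : deriv (deriv f) x₀ ≤ 0 := by
  by_contra! hpos
  have hmin := isLocalMin_of_deriv_deriv_pos hpos h.deriv_eq_zero hf
  have hconst : f =ᶠ[nhds x₀] fun _ => f x₀ := by
    filter_upwards [h, hmin] with x h₁ h₂ using le_antisymm h₁ h₂
  have hzero : deriv (deriv f) x₀ = 0 := by
    rw [hconst.deriv.deriv_eq]; simp
  exact hpos.ne' hzero

theorem stmt_18 (a b : ℝ) (ha : 0 < a) (hb : 0 < b) (θ q : ℝ → ℝ)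
    (hθ : ContDiff ℝ (⊤ : ℕ∞) θ) (hq : ContDiff ℝ (⊤ : ℕ∞) q)
    (hθp : Function.Periodic θ 1) (hqp : Function.Periodic q 1)
    (heq : ∀ y : ℝ, -deriv (deriv q) y + a * q y + b * deriv (fun z => (θ z) ^ 4) y = 0) :
    ∀ y : ℝ, deriv q y ≤ b * (θ y) ^ 4 := by
  have hq' : Differentiable ℝ (deriv q) :=
    ((contDiff_infty_iff_deriv.1 hq).2).differentiable (by simp)
  have hθ' : Differentiable ℝ fun z => θ z ^ 4 := (hθ.differentiable (by simp)).pow 4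
  set w : ℝ → ℝ := fun y => deriv q y - b * θ y ^ 4 with hw
  have hwd : Differentiable ℝ w := hq'.sub (hθ'.const_mul b)
  have hw' : deriv w = fun y => a * q y := by
    funext y
    rw [hw, deriv_fun_sub (hq' y) ((hθ' y).const_mul b), deriv_const_mul _ (hθ' y)]
    linarith [heq y]
  have hwp : Function.Periodic w 1 := fun y => by
    simp only [hw, hqp.periodic_deriv y, hθp y]
  obtain ⟨y₀, hy₀⟩ := hwp.exists_forall_le_of_continuous one_pos hwd.continuous
  have hmax : IsLocalMax w y₀ := Filter.Eventually.of_forall hy₀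
  have hw'' := hmax.deriv_deriv_nonpos hwd.continuous.continuousAt
  rw [hw', deriv_const_mul _ (hq.differentiable (by simp) y₀)] at hw''
  have hq₀ : deriv q y₀ ≤ 0 := nonpos_of_mul_nonpos_right hw'' ha
  intro y
  have hθ₀ : 0 ≤ b * θ y₀ ^ 4 := by positivity
  have hy : deriv q y - b * θ y ^ 4 ≤ deriv q y₀ - b * θ y₀ ^ 4 := hy₀ y
  linarith
end
end
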